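/- arXiv:math/0601463 — 2 statements merged into one kernel-verified Lean document; each statement's English description precedes it below -/
import Mathlib

section
/- For integers k ≥ 2, 1 ≤ i ≤ k, and complex a, q with 0 < |q| < 1 and a such that all Pochhammer symbols appearing are nonzero (e.g. a > 0 real), Σ_{n_1 ≥ n_2 ≥ … ≥ n_{k−1} ≥ 0} q^{n_1(n_1+1)/2 + n_2² + ⋯ + n_{k−1}² + n_i + ⋯ + n_{k−1}} (−1/a;q)_{n_1} a^{n_1} / ((q;q)_{n_1−n_2} ⋯ (q;q)_{n_{k−2}−n_{k−1}} (q;q)_{n_{k−1}}) = ((−aq;q)_∞/(q;q)_∞) Σ_{n=−∞}^{∞} (−1)^n a^n q^{kn² + (k−i+1)n} (−1/a;q)_n / (−aq;q)_n. -/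
namespace Paper

open scoped Classical

/-- The infinite q-Pochhammer symbol `(x;q)_∞ = ∏_{i≥0} (1 - x qⁱ)`. -/
noncomputable def qPochInf (x q : ℂ) : ℂ := ∏' i : ℕ, (1 - x * q ^ i)

/-- The finite q-Pochhammer symbol `(x;q)_N = ∏_{i=0}^{N-1} (1 - x qⁱ)`. -/
noncomputable def qPochN (x q : ℂ) (N : ℕ) : ℂ := ∏ i ∈ Finset.range N, (1 - x * q ^ i)

/-- The q-Pochhammer symbol with arbitrary integer index,
`(x;q)_n = (x;q)_∞ / (x qⁿ;q)_∞`. -/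
noncomputable def qPochZ (x q : ℂ) (n : ℤ) : ℂ := qPochInf x q / qPochInf (x * q ^ n) q

open Filter Topology

/-! ### Infinite products -/

lemma summable_norm_mul_pow {q : ℂ} (hq1 : ‖q‖ < 1) (x : ℂ) :
    Summable fun i : ℕ => ‖-(x * q ^ i)‖ := by
  simpa using (summable_geometric_of_lt_one (norm_nonneg q) hq1).mul_left ‖x‖

lemma multipliable_qPochInf {q : ℂ} (hq1 : ‖q‖ < 1) (x : ℂ) :
    Multipliable fun i : ℕ => 1 - x * q ^ i := by
  simpa [sub_eq_add_neg] using multipliable_one_add_of_summable (summable_norm_mul_pow hq1 x)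

lemma tendsto_qPochN {q : ℂ} (hq1 : ‖q‖ < 1) (x : ℂ) :
    Tendsto (qPochN x q) atTop (𝓝 (qPochInf x q)) :=
  (multipliable_qPochInf hq1 x).hasProd.tendsto_prod_nat

lemma qPochInf_eq_mul {q : ℂ} (hq1 : ‖q‖ < 1) (x : ℂ) :
    qPochInf x q = (1 - x) * qPochInf (x * q) q := by
  have h := multipliable_qPochInf hq1 (x * q)
  have h' : Multipliable fun i : ℕ => 1 - x * q ^ (i + 1) := by
    simpa [pow_succ', mul_assoc] using h
  have := tprod_eq_zero_mul' (f := fun i : ℕ => 1 - x * q ^ i) h'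
  simpa [qPochInf, pow_succ', mul_assoc] using this

lemma qPochInf_ne_zero {q : ℂ} (hq1 : ‖q‖ < 1) {x : ℂ} (hx : ∀ i : ℕ, 1 - x * q ^ i ≠ 0) :
    qPochInf x q ≠ 0 := by
  have := tprod_one_add_ne_zero_of_summable (f := fun i : ℕ => -(x * q ^ i))
    (by simpa [sub_eq_add_neg] using hx) (summable_norm_mul_pow hq1 x)
  simpa [qPochInf, sub_eq_add_neg] using this

lemma one_sub_pow_succ_ne_zero {q : ℂ} (hq1 : ‖q‖ < 1) (i : ℕ) : 1 - q ^ (i + 1) ≠ 0 := by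
  intro h
  have h1 : ‖q ^ (i + 1)‖ = 1 := by rw [← sub_eq_zero.mp h, norm_one]
  rw [norm_pow] at h1
  exact absurd h1 (pow_lt_one₀ (norm_nonneg q) hq1 (Nat.succ_ne_zero i)).ne

lemma qPochN_self_ne_zero {q : ℂ} (hq1 : ‖q‖ < 1) (n : ℕ) : qPochN q q n ≠ 0 :=
  Finset.prod_ne_zero_iff.mpr fun i _ => by
    simpa [pow_succ'] using one_sub_pow_succ_ne_zero hq1 i

lemma qPochInf_self_ne_zero {q : ℂ} (hq1 : ‖q‖ < 1) : qPochInf q q ≠ 0 :=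
  qPochInf_ne_zero hq1 fun i => by simpa [pow_succ'] using one_sub_pow_succ_ne_zero hq1 i

/-! ### Reciprocal of `(q;q)_n`, extended by zero to negative `n` -/

/-- `1 / (q;q)_n`, with the usual convention that it vanishes for negative `n`. -/
noncomputable def invPoch (q : ℂ) (n : ℤ) : ℂ := if 0 ≤ n then (qPochN q q n.toNat)⁻¹ else 0

lemma invPoch_natCast (q : ℂ) (n : ℕ) : invPoch q n = (qPochN q q n)⁻¹ := by
  simp [invPoch]

lemma invPoch_of_neg (q : ℂ) {n : ℤ} (hn : n < 0) : invPoch q n = 0 := by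
  simp [invPoch, hn]

@[simp]
lemma invPoch_zero (q : ℂ) : invPoch q 0 = 1 := by
  simp [invPoch, qPochN]

lemma invPoch_mul_one_sub {q : ℂ} (hq1 : ‖q‖ < 1) (n : ℤ) :
    invPoch q n * (1 - q ^ n) = invPoch q (n - 1) := by
  rcases lt_trichotomy n 0 with h | rfl | h
  · rw [invPoch_of_neg q h, invPoch_of_neg q (by lia), zero_mul]
  · rw [invPoch_of_neg q (show (0 : ℤ) - 1 < 0 by simp)]
    simp
  · obtain ⟨m, rfl⟩ : ∃ m : ℕ, n = (m + 1 : ℕ) := ⟨(n - 1).toNat, by lia⟩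
    have h1 : ((m + 1 : ℕ) : ℤ) - 1 = (m : ℕ) := by push_cast; ring
    rw [h1, invPoch_natCast, invPoch_natCast, zpow_natCast]
    have h2 : qPochN q q (m + 1) = qPochN q q m * (1 - q ^ (m + 1)) := by
      rw [qPochN, Finset.prod_range_succ, pow_succ']; rfl
    rw [h2]
    have := one_sub_pow_succ_ne_zero hq1 m
    have := qPochN_self_ne_zero hq1 m
    field_simp

lemma tendsto_invPoch {q : ℂ} (hq1 : ‖q‖ < 1) :
    Tendsto (fun n : ℕ => invPoch q n) atTop (𝓝 (qPochInf q q)⁻¹) := by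
  simp_rw [invPoch_natCast]
  exact (tendsto_qPochN hq1 q).inv₀ (qPochInf_self_ne_zero hq1)

lemma exists_norm_invPoch_le {q : ℂ} (hq1 : ‖q‖ < 1) :
    ∃ C : ℝ, 0 < C ∧ ∀ n : ℤ, ‖invPoch q n‖ ≤ C := by
  obtain ⟨C, hC, h⟩ := (Metric.isBounded_range_of_tendsto _ (tendsto_invPoch hq1)).exists_pos_norm_le
  refine ⟨C, hC, fun n => ?_⟩
  rcases lt_or_ge n 0 with hn | hn
  · rw [invPoch_of_neg q hn, norm_zero]; exact hC.le
  · lift n to ℕ using hn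
    exact h _ ⟨n, rfl⟩

/-! ### Bookkeeping for sums over the integers -/

lemma tsum_int_eq_tsum_nat {f : ℤ → ℂ} (hf : ∀ n < 0, f n = 0) :
    ∑' n : ℤ, f n = ∑' n : ℕ, f n := by
  refine (Function.Injective.tsum_eq Nat.cast_injective fun n hn => ?_).symm
  have : 0 ≤ n := not_lt.mp fun h => hn (hf n h)
  exact ⟨n.toNat, by simp [this]⟩

lemma tsum_int_eq_sum_range {f : ℤ → ℂ} {N : ℕ} (hf : ∀ n < 0, f n = 0)
    (hf' : ∀ n : ℤ, N < n → f n = 0) :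
    ∑' n : ℤ, f n = ∑ n ∈ Finset.range (N + 1), f n := by
  rw [tsum_int_eq_tsum_nat hf]
  exact tsum_eq_sum fun n hn => hf' n (by simp at hn; lia)

lemma summable_of_eq_zero_of_lt {f : ℤ → ℂ} (M N : ℤ) (hf : ∀ n < M, f n = 0)
    (hf' : ∀ n, N < n → f n = 0) : Summable f :=
  summable_of_ne_finset_zero (s := Finset.Icc M N) fun n hn => by
    rcases lt_or_ge n M with h | h
    · exact hf n h
    · exact hf' n (by simp at hn; lia)

/-! ### Finite `q`-summations -/

/-- The terminating `q`-Gauss (`q`-Chu–Vandermonde) sum. -/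
lemma sum_qGauss {q : ℂ} (hq0 : q ≠ 0) (hq1 : ‖q‖ < 1) (y : ℂ) (M : ℕ) (C : ℤ) :
    ∑ m ∈ Finset.range (M + 1), (∏ i ∈ Finset.range m, q ^ i * (q ^ (C + 1 + i) - y)) *
      (invPoch q (M - m) * invPoch q m * invPoch q (m + C)) =
      qPochN y q M * invPoch q M * invPoch q (M + C) := by
  induction M generalizing C with
  | zero => simp [qPochN]
  | succ M ih =>
    have hM : (1 - q ^ (M + 1) : ℂ) ≠ 0 := one_sub_pow_succ_ne_zero hq1 M
    apply mul_left_cancel₀ hM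
    have split : ∀ m : ℕ, (1 - q ^ (M + 1) : ℂ) *
        ((∏ i ∈ Finset.range m, q ^ i * (q ^ (C + 1 + i) - y)) *
          (invPoch q ((M + 1 : ℕ) - m) * invPoch q m * invPoch q (m + C))) =
        (∏ i ∈ Finset.range m, q ^ i * (q ^ (C + 1 + i) - y)) *
          (invPoch q (M - m) * invPoch q m * invPoch q (m + C)) +
        (∏ i ∈ Finset.range m, q ^ i * (q ^ (C + 1 + i) - y)) * q ^ ((M : ℤ) + 1 - m) *
          (invPoch q (M + 1 - m) * invPoch q (m - 1) * invPoch q (m + C)) := by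
      intro m
      have h1 := invPoch_mul_one_sub hq1 ((M : ℤ) + 1 - m)
      have h2 := invPoch_mul_one_sub hq1 (m : ℤ)
      rw [show (M : ℤ) + 1 - m - 1 = M - m by ring] at h1
      have h3 : (q : ℂ) ^ (M + 1) = q ^ ((M : ℤ) + 1 - m) * q ^ (m : ℤ) := by
        rw [← zpow_add₀ hq0, ← zpow_natCast]; congr 1; push_cast; ring
      rw [← h1, ← h2, h3]
      push_cast
      ring
    rw [Finset.mul_sum, Finset.sum_congr rfl fun m _ => split m, Finset.sum_add_distrib]
    have first : ∑ m ∈ Finset.range (M + 1 + 1),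
        (∏ i ∈ Finset.range m, q ^ i * (q ^ (C + 1 + i) - y)) *
          (invPoch q (M - m) * invPoch q m * invPoch q (m + C)) =
        qPochN y q M * invPoch q M * invPoch q (M + C) := by
      rw [Finset.sum_range_succ, ih, invPoch_of_neg q (n := (M : ℤ) - (M + 1 : ℕ)) (by lia)]
      ring
    have second : ∑ m ∈ Finset.range (M + 1 + 1),
        (∏ i ∈ Finset.range m, q ^ i * (q ^ (C + 1 + i) - y)) * q ^ ((M : ℤ) + 1 - m) *
          (invPoch q (M + 1 - m) * invPoch q (m - 1) * invPoch q (m + C)) =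
        q ^ M * (q ^ (C + 1) - y) *
          (qPochN y q M * invPoch q M * invPoch q (M + (C + 1))) := by
      rw [Finset.sum_range_succ', ← ih, Finset.mul_sum,
        invPoch_of_neg q (n := ((0 : ℕ) : ℤ) - 1) (by lia)]
      simp only [mul_zero, zero_mul, add_zero]
      refine Finset.sum_congr rfl fun m _ => ?_
      rw [Finset.prod_range_succ']
      have e1 : ∀ i : ℕ, C + 1 + ((i + 1 : ℕ) : ℤ) = C + 1 + 1 + i := fun i => by push_cast; ring
      have e2 : (M : ℤ) + 1 - (m + 1 : ℕ) = M - m := by push_cast; ring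
      have e3 : ((m + 1 : ℕ) : ℤ) - 1 = m := by push_cast; ring
      have e4 : ((m + 1 : ℕ) : ℤ) + C = m + (C + 1) := by push_cast; ring
      have e5 : ∏ i ∈ Finset.range m, q ^ (i + 1) * (q ^ (C + 1 + 1 + (i : ℤ)) - y) =
          q ^ (m : ℤ) * ∏ i ∈ Finset.range m, q ^ i * (q ^ (C + 1 + 1 + (i : ℤ)) - y) := by
        have : (q : ℂ) ^ m = ∏ _i ∈ Finset.range m, q := by simp
        rw [zpow_natCast, this, ← Finset.prod_mul_distrib]
        exact Finset.prod_congr rfl fun i _ => by ring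
      have e6 : (q : ℂ) ^ M = q ^ ((M : ℤ) - m) * q ^ (m : ℤ) := by
        rw [← zpow_add₀ hq0, ← zpow_natCast]; congr 1; ring
      simp only [e1, e2, e3, e4]
      rw [e5, e6]
      simp
      ring
    rw [first, second]
    have h1 := invPoch_mul_one_sub hq1 ((M + 1 : ℕ) : ℤ)
    have h2 := invPoch_mul_one_sub hq1 ((M : ℤ) + (C + 1))
    rw [show ((M + 1 : ℕ) : ℤ) - 1 = M by push_cast; ring, zpow_natCast] at h1
    rw [show (M : ℤ) + (C + 1) - 1 = M + C by ring] at h2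
    have h3 : qPochN y q (M + 1) = qPochN y q M * (1 - y * q ^ M) := Finset.prod_range_succ ..
    have h4 : (q : ℂ) ^ ((M : ℤ) + (C + 1)) = q ^ M * q ^ (C + 1) := by
      rw [zpow_add₀ hq0, zpow_natCast]
    rw [h3, show ((M + 1 : ℕ) : ℤ) + C = M + (C + 1) by push_cast; ring, ← h1, ← h2, h4]
    ring

/-- The finite form of Euler's `q`-binomial theorem. -/
lemma sum_qBinomial {q : ℂ} (hq0 : q ≠ 0) (hq1 : ‖q‖ < 1) (z : ℂ) (N : ℕ) :
    ∑ j ∈ Finset.range (N + 1), (∏ i ∈ Finset.range j, -(z * q ^ i)) *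
      (invPoch q j * invPoch q (N - j)) = qPochN z q N * invPoch q N := by
  induction N with
  | zero => simp [qPochN]
  | succ N ih =>
    apply mul_left_cancel₀ (one_sub_pow_succ_ne_zero hq1 N)
    have split : ∀ j : ℕ, (1 - q ^ (N + 1) : ℂ) * ((∏ i ∈ Finset.range j, -(z * q ^ i)) *
        (invPoch q j * invPoch q ((N + 1 : ℕ) - j))) =
        (∏ i ∈ Finset.range j, -(z * q ^ i)) * (invPoch q j * invPoch q (N - j)) +
        (∏ i ∈ Finset.range j, -(z * q ^ i)) * q ^ ((N : ℤ) + 1 - j) *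
          (invPoch q (j - 1) * invPoch q (N + 1 - j)) := by
      intro j
      have h1 := invPoch_mul_one_sub hq1 ((N : ℤ) + 1 - j)
      have h2 := invPoch_mul_one_sub hq1 (j : ℤ)
      rw [show (N : ℤ) + 1 - j - 1 = N - j by ring] at h1
      have h3 : (q : ℂ) ^ (N + 1) = q ^ ((N : ℤ) + 1 - j) * q ^ (j : ℤ) := by
        rw [← zpow_add₀ hq0, ← zpow_natCast]; congr 1; push_cast; ring
      rw [← h1, ← h2, h3]
      push_cast
      ring
    rw [Finset.mul_sum, Finset.sum_congr rfl fun j _ => split j, Finset.sum_add_distrib,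
      Finset.sum_range_succ, ih, invPoch_of_neg q (n := (N : ℤ) - (N + 1 : ℕ)) (by lia),
      Finset.sum_range_succ', invPoch_of_neg q (n := ((0 : ℕ) : ℤ) - 1) (by lia)]
    have second : ∑ j ∈ Finset.range (N + 1), (∏ i ∈ Finset.range (j + 1), -(z * q ^ i)) *
        q ^ ((N : ℤ) + 1 - (j + 1 : ℕ)) *
          (invPoch q ((j + 1 : ℕ) - 1) * invPoch q (N + 1 - (j + 1 : ℕ))) =
        -(z * q ^ N) * (qPochN z q N * invPoch q N) := by
      rw [← ih, Finset.mul_sum]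
      refine Finset.sum_congr rfl fun j _ => ?_
      have e2 : (N : ℤ) + 1 - (j + 1 : ℕ) = N - j := by push_cast; ring
      have e3 : ((j + 1 : ℕ) : ℤ) - 1 = j := by push_cast; ring
      have e6 : (q : ℂ) ^ N = q ^ ((N : ℤ) - j) * q ^ j := by
        rw [← zpow_natCast q j, ← zpow_add₀ hq0, ← zpow_natCast]; congr 1; ring
      rw [Finset.prod_range_succ, e2, e3, e6]
      ring
    have h1 := invPoch_mul_one_sub hq1 ((N + 1 : ℕ) : ℤ)
    rw [show ((N + 1 : ℕ) : ℤ) - 1 = N by push_cast; ring, zpow_natCast] at h1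
    have h3 : qPochN z q (N + 1) = qPochN z q N * (1 - z * q ^ N) := Finset.prod_range_succ ..
    rw [second, h3, ← h1]
    ring

/-! ### Bilateral Bailey pairs -/

/-- The member `β_n` of the bilateral Bailey pair with `α = A`, relative to `q ^ c`. -/
noncomputable def bailey (q : ℂ) (c : ℤ) (A : ℤ → ℂ) (n : ℕ) : ℂ :=
  ∑' r : ℤ, A r * (invPoch q (n - r) * invPoch q (n + r + c))

lemma summable_bailey (q : ℂ) (c : ℤ) (A : ℤ → ℂ) (n : ℕ) :
    Summable fun r : ℤ => A r * (invPoch q (n - r) * invPoch q (n + r + c)) := by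
  refine summable_of_eq_zero_of_lt (-n - c) n (fun r hr => ?_) fun r hr => ?_
  · rw [invPoch_of_neg q (n := n + r + c) (by lia)]; ring
  · rw [invPoch_of_neg q (n := n - r) (by lia)]; ring

lemma prod_range_pow_mul_zpow {q : ℂ} (hq0 : q ≠ 0) (C : ℤ) (m : ℕ) :
    ∏ i ∈ Finset.range m, q ^ i * (q ^ (C + 1 + i) - 0) = q ^ ((m : ℤ) ^ 2 + C * m) := by
  induction m with
  | zero => simp
  | succ m ih =>
    rw [Finset.prod_range_succ, ih, sub_zero, ← zpow_natCast q m, ← zpow_add₀ hq0,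
      ← zpow_add₀ hq0]
    congr 1; push_cast; ring

lemma sum_qVandermonde {q : ℂ} (hq0 : q ≠ 0) (hq1 : ‖q‖ < 1) {c : ℤ} (hc : c ≤ 1)
    (L : ℕ) (r : ℤ) :
    ∑ n ∈ Finset.range (L + 1), q ^ ((n : ℤ) ^ 2 + c * n) * invPoch q (L - n) *
        (invPoch q (n - r) * invPoch q (n + r + c)) =
      q ^ (r ^ 2 + c * r) * (invPoch q (L - r) * invPoch q (L + r + c)) := by
  rw [← tsum_int_eq_sum_range (N := L) (f := fun n : ℤ => q ^ (n ^ 2 + c * n) * invPoch q (L - n) *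
        (invPoch q (n - r) * invPoch q (n + r + c))), ← (Equiv.addRight r).tsum_eq]
  · simp only [Equiv.coe_addRight, add_sub_cancel_right]
    rcases lt_or_ge (L - r) 0 with h | h
    · rw [invPoch_of_neg q h, zero_mul, mul_zero, ← tsum_zero (α := ℂ) (β := ℤ)]
      refine tsum_congr fun m => ?_
      rcases lt_or_ge m 0 with hm | hm
      · rw [invPoch_of_neg q hm]; ring
      · rw [invPoch_of_neg q (n := L - (m + r)) (by lia)]; ring
    · obtain ⟨M, hM⟩ : ∃ M : ℕ, (L : ℤ) - r = M := ⟨_, (Int.toNat_of_nonneg h).symm⟩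
      rw [tsum_int_eq_sum_range (N := M), hM, show (L : ℤ) + r + c = M + (2 * r + c) by lia]
      · have := sum_qGauss hq0 hq1 0 M (2 * r + c)
        simp only [prod_range_pow_mul_zpow hq0] at this
        rw [show qPochN 0 q M = 1 by simp [qPochN], one_mul] at this
        rw [← this, Finset.mul_sum]
        refine Finset.sum_congr rfl fun m _ => ?_
        rw [show (L : ℤ) - (m + r) = M - m by lia,
          show (m : ℤ) + r + r + c = m + (2 * r + c) by ring,
          show ((m : ℤ) + r) ^ 2 + c * (m + r) =
            (r ^ 2 + c * r) + ((m : ℤ) ^ 2 + (2 * r + c) * m) by ring, zpow_add₀ hq0]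
        ring
      · intro m hm
        rw [invPoch_of_neg q hm]; ring
      · intro m hm
        rw [invPoch_of_neg q (n := L - (m + r)) (by lia)]; ring
  · intro n hn
    rcases lt_or_ge n r with h | h
    · rw [invPoch_of_neg q (n := n - r) (by lia)]; ring
    · rw [invPoch_of_neg q (n := n + r + c) (by lia)]; ring
  · intro n hn
    rw [invPoch_of_neg q (n := L - n) (by lia)]; ring

lemma bailey_step {q : ℂ} (hq0 : q ≠ 0) (hq1 : ‖q‖ < 1) {c : ℤ} (hc : c ≤ 1)
    (A : ℤ → ℂ) (L : ℕ) :
    ∑ n ∈ Finset.range (L + 1), q ^ ((n : ℤ) ^ 2 + c * n) * invPoch q (L - n) * bailey q c A n =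
      bailey q c (fun r => q ^ (r ^ 2 + c * r) * A r) L := by
  simp only [bailey, ← tsum_mul_left]
  rw [← Summable.tsum_finsetSum fun n _ => (summable_bailey q c A n).mul_left _]
  refine tsum_congr fun r => ?_
  rw [mul_right_comm, ← sum_qVandermonde hq0 hq1 hc, Finset.sum_mul]
  exact Finset.sum_congr rfl fun n _ => by ring

lemma bailey_zero_eq {q : ℂ} (hq0 : q ≠ 0) (hq1 : ‖q‖ < 1) (A : ℤ → ℂ) (n : ℕ) :
    bailey q 0 A n = bailey q 1 A n - q ^ (n + 1) * bailey q 1 (fun r => A r * q ^ r) n := by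
  simp only [bailey, ← tsum_mul_left]
  rw [← Summable.tsum_sub (summable_bailey q 1 A n)
    ((summable_bailey q 1 (fun r => A r * q ^ r) n).mul_left _)]
  refine tsum_congr fun r => ?_
  have h := invPoch_mul_one_sub hq1 ((n : ℤ) + r + 1)
  rw [show (n : ℤ) + r + 1 - 1 = n + r + 0 by ring] at h
  rw [← h, show (n : ℤ) + r + 1 = (n + 1 : ℕ) + r by push_cast; ring, zpow_add₀ hq0, zpow_natCast]
  ring

lemma bailey_one_reflect (q : ℂ) (A : ℤ → ℂ) (n : ℕ) :
    bailey q 1 (fun r => A (-1 - r)) n = bailey q 1 A n := by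
  rw [bailey, bailey, ← (Equiv.subLeft (-1 : ℤ)).tsum_eq]
  refine tsum_congr fun r => ?_
  simp only [Equiv.subLeft_apply]
  rw [show (n : ℤ) - (-1 - r) = n + r + 1 by ring, show (n : ℤ) + (-1 - r) + 1 = n - r by ring,
    show -1 - (-1 - r) = r by ring]
  ring

lemma bailey_neg (q : ℂ) (c : ℤ) (A : ℤ → ℂ) (n : ℕ) :
    bailey q c (fun r => -A r) n = -bailey q c A n := by
  simp only [bailey, neg_mul, tsum_neg]

lemma bailey_mul_left (q : ℂ) (c : ℤ) (b : ℂ) (A : ℤ → ℂ) (n : ℕ) :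
    bailey q c (fun r => b * A r) n = b * bailey q c A n := by
  simp only [bailey, mul_assoc, tsum_mul_left]

/-! ### The Andrews–Gordon Bailey pair -/

/-- The coefficients `(-1)^r q^(D r² + e r + r (r - 1) / 2)`. -/
noncomputable def gordonCoeff (q : ℂ) (D e r : ℤ) : ℂ :=
  (-1) ^ r * q ^ (D * r ^ 2 + e * r + r * (r - 1) / 2)

lemma two_mul_tri (r : ℤ) : 2 * (r * (r - 1) / 2) = r * (r - 1) :=
  Int.mul_ediv_cancel' (by simpa [mul_comm] using (Int.even_mul_pred_self r).two_dvd)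

lemma gordonCoeff_mul_zpow {q : ℂ} (hq0 : q ≠ 0) (D e r : ℤ) :
    gordonCoeff q D e r * q ^ r = gordonCoeff q D (e + 1) r := by
  rw [gordonCoeff, gordonCoeff, mul_assoc, ← zpow_add₀ hq0]
  congr 2; ring

lemma zpow_mul_gordonCoeff {q : ℂ} (hq0 : q ≠ 0) (c D e r : ℤ) :
    q ^ (r ^ 2 + c * r) * gordonCoeff q D e r = gordonCoeff q (D + 1) (e + c) r := by
  rw [gordonCoeff, gordonCoeff, mul_left_comm, ← zpow_add₀ hq0]
  congr 2; ring

lemma gordonCoeff_reflect {q : ℂ} (hq0 : q ≠ 0) (D e r : ℤ) :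
    gordonCoeff q D (D + 1 + e) (-1 - r) = -(q ^ (-e) * gordonCoeff q D (D + 1 - e) r) := by
  have h1 := two_mul_tri r
  have h2 := two_mul_tri (-1 - r)
  have h3 : (-1 - r) * (-1 - r - 1) / 2 = r * (r - 1) / 2 + 2 * r + 1 := by linarith
  rw [gordonCoeff, gordonCoeff, mul_left_comm, ← zpow_add₀ hq0, h3, ← neg_mul]
  congr 1
  · rw [zpow_sub₀ (by norm_num : (-1 : ℂ) ≠ 0), zpow_neg_one]
    rcases Int.even_or_odd r with h | h <;> simp [h.neg_one_zpow]
  · congr 1; ring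

lemma bailey_gordonCoeff_zero {q : ℂ} (hq0 : q ≠ 0) (hq1 : ‖q‖ < 1) (n : ℕ) :
    bailey q 1 (gordonCoeff q 0 0) n = if n = 0 then 1 else 0 := by
  have coeff : ∀ j : ℕ, gordonCoeff q 0 0 (j - (n + 1)) = gordonCoeff q 0 0 (-(n + 1)) *
      ∏ i ∈ Finset.range j, -(q ^ (-((n : ℤ) + 1)) * q ^ i) := by
    intro j
    induction j with
    | zero => simp
    | succ j ih =>
      rw [Finset.prod_range_succ, ← mul_assoc, ← ih, gordonCoeff, gordonCoeff]
      have h1 := two_mul_tri ((j : ℤ) - (n + 1))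
      have h2 := two_mul_tri (((j + 1 : ℕ) : ℤ) - (n + 1))
      have h3 : (((j + 1 : ℕ) : ℤ) - (n + 1)) * (((j + 1 : ℕ) : ℤ) - (n + 1) - 1) / 2 =
          ((j : ℤ) - (n + 1)) * ((j : ℤ) - (n + 1) - 1) / 2 + (j - (n + 1)) := by
        push_cast at *; linarith
      rw [h3, ← zpow_natCast q j, ← zpow_add₀ hq0, mul_neg, mul_assoc, ← zpow_add₀ hq0,
        show ((j + 1 : ℕ) : ℤ) - (n + 1) = (j - (n + 1)) + 1 by push_cast; ring,
        zpow_add₀ (by norm_num : (-1 : ℂ) ≠ 0), zpow_one, mul_neg_one, neg_mul]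
      congr 3; ring
  have main : bailey q 1 (gordonCoeff q 0 0) n = gordonCoeff q 0 0 (-(n + 1)) *
      (qPochN (q ^ (-((n : ℤ) + 1))) q (2 * n + 1) * invPoch q (2 * n + 1 : ℕ)) := by
    rw [← sum_qBinomial hq0 hq1, bailey, ← (Equiv.subRight ((n : ℤ) + 1)).tsum_eq]
    simp only [Equiv.subRight_apply]
    rw [tsum_int_eq_sum_range (N := 2 * n + 1), Finset.mul_sum]
    · refine Finset.sum_congr rfl fun j _ => ?_
      rw [coeff, show (n : ℤ) - (j - (n + 1)) = (2 * n + 1 : ℕ) - j by push_cast; ring,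
        show (n : ℤ) + (j - (n + 1)) + 1 = j by ring]
      ring
    · intro j hj
      rw [invPoch_of_neg q (n := n + (j - (n + 1)) + 1) (by lia)]; ring
    · intro j hj
      rw [invPoch_of_neg q (n := n - (j - (n + 1))) (by lia)]; ring
  rw [main]
  split_ifs with hn
  · subst hn
    have := one_sub_pow_succ_ne_zero hq1 0
    simp only [zero_add, pow_one] at this
    rw [invPoch_natCast]
    simp [gordonCoeff, qPochN]
    field_simp
    ring
  · have : qPochN (q ^ (-((n : ℤ) + 1))) q (2 * n + 1) = 0 := by
      refine Finset.prod_eq_zero (i := n + 1) (by simp; lia) ?_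
      rw [← zpow_natCast, ← zpow_add₀ hq0]
      simp
    rw [this]; ring

lemma bailey_gordonCoeff_antisymm {q : ℂ} (hq0 : q ≠ 0) (D : ℤ) (n : ℕ) :
    bailey q 1 (gordonCoeff q D (D + 1)) n = 0 := by
  have h := bailey_one_reflect q (gordonCoeff q D (D + 1)) n
  have h' : (fun r => gordonCoeff q D (D + 1) (-1 - r)) =
      fun r => -gordonCoeff q D (D + 1) r := by
    ext r
    simpa using gordonCoeff_reflect hq0 D 0 r
  rw [h', bailey_neg] at h
  exact self_eq_neg.mp h.symm

lemma bailey_zero_gordonCoeff {q : ℂ} (hq0 : q ≠ 0) (hq1 : ‖q‖ < 1) (D : ℤ) (n : ℕ) :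
    bailey q 0 (gordonCoeff q D D) n = bailey q 1 (gordonCoeff q D D) n := by
  rw [bailey_zero_eq hq0 hq1]
  simp only [gordonCoeff_mul_zpow hq0, bailey_gordonCoeff_antisymm hq0, mul_zero, sub_zero]

lemma bailey_zero_gordonCoeff_succ {q : ℂ} (hq0 : q ≠ 0) (hq1 : ‖q‖ < 1) (D : ℤ) (n : ℕ) :
    bailey q 0 (gordonCoeff q D (D + 1)) n = q ^ n * bailey q 1 (gordonCoeff q D D) n := by
  rw [bailey_zero_eq hq0 hq1]
  simp only [gordonCoeff_mul_zpow hq0, bailey_gordonCoeff_antisymm hq0, zero_sub]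
  have h : (fun r => gordonCoeff q D (D + 1 + 1) (-1 - r)) =
      fun r => -q⁻¹ * gordonCoeff q D D r := by
    ext r
    rw [gordonCoeff_reflect hq0, add_sub_cancel_right, zpow_neg_one]
    ring
  rw [← bailey_one_reflect, h, bailey_mul_left, pow_succ]
  field_simp

/-! ### The iterated finite sums -/

/-- The sum over `L ≥ n_1 ≥ ⋯ ≥ n_d ≥ 0` of
`q ^ (n_1² + ⋯ + n_d² + n_{p+1} + ⋯ + n_d)` divided by
`(q;q)_{L - n_1} ⋯ (q;q)_{n_{d-1} - n_d} (q;q)_{n_d}`. -/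
noncomputable def chainSum (q : ℂ) : ℕ → ℕ → ℕ → ℂ
  | 0, _, L => invPoch q L
  | d + 1, p, L => ∑ n ∈ Finset.range (L + 1),
      q ^ (n ^ 2 + if p = 0 then n else 0) * invPoch q (L - n) * chainSum q d (p - 1) n

lemma chainSum_zero_right {q : ℂ} (hq0 : q ≠ 0) (hq1 : ‖q‖ < 1) (d L : ℕ) :
    chainSum q d 0 L = bailey q 1 (gordonCoeff q (d + 1) (d + 1)) L := by
  have step : ∀ (D : ℤ) (L : ℕ), ∑ n ∈ Finset.range (L + 1), q ^ (n ^ 2 + n) *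
      invPoch q (L - n) * bailey q 1 (gordonCoeff q D D) n =
      bailey q 1 (gordonCoeff q (D + 1) (D + 1)) L := by
    intro D L
    have := bailey_step hq0 hq1 le_rfl (gordonCoeff q D D) L
    simp only [zpow_mul_gordonCoeff hq0] at this
    rw [← this]
    refine Finset.sum_congr rfl fun n _ => ?_
    rw [← zpow_natCast]
    push_cast
    rw [one_mul]
  induction d generalizing L with
  | zero =>
    have := step 0 L
    simp only [bailey_gordonCoeff_zero hq0 hq1] at this
    simpa [chainSum] using this
  | succ d ih =>
    rw [chainSum]
    simp only [ih, if_true, zero_tsub]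
    push_cast
    exact step _ L

lemma chainSum_eq_bailey {q : ℂ} (hq0 : q ≠ 0) (hq1 : ‖q‖ < 1) {d p : ℕ} (hp : p ≤ d) (L : ℕ) :
    chainSum q d p L = bailey q 0 (gordonCoeff q (d + 1) (d + 1 - p)) L := by
  induction d generalizing p L with
  | zero =>
    obtain rfl : p = 0 := by lia
    rw [chainSum_zero_right hq0 hq1, ← bailey_zero_gordonCoeff hq0 hq1]
    simp
  | succ d ih =>
    rcases p with _ | p
    · rw [chainSum_zero_right hq0 hq1, ← bailey_zero_gordonCoeff hq0 hq1]
      simp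
    · have := bailey_step hq0 hq1 zero_le_one (gordonCoeff q (d + 1) (d + 1 - p)) L
      simp only [zpow_mul_gordonCoeff hq0] at this
      rw [chainSum]
      simp only [Nat.add_sub_cancel, ih (Nat.le_of_succ_le_succ hp)]
      push_cast
      rw [show (d : ℤ) + 1 + 1 - (p + 1) = d + 1 - p + 0 by ring, ← this]
      refine Finset.sum_congr rfl fun n _ => ?_
      rw [← zpow_natCast]
      simp

/-- A single term of `chainSum`, for a not necessarily decreasing tuple. -/
noncomputable def chainTerm (q : ℂ) : (d : ℕ) → ℕ → ℕ → (Fin d → ℕ) → ℂ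
  | 0, _, L, _ => invPoch q L
  | d + 1, p, L, g => q ^ (g 0 ^ 2 + if p = 0 then g 0 else 0) * invPoch q (L - g 0) *
      chainTerm q d (p - 1) (g 0) (Fin.tail g)

lemma summable_prod_pow {x : ℝ} (hx0 : 0 ≤ x) (hx1 : x < 1) (d : ℕ) :
    Summable fun g : Fin d → ℕ => ∏ m, x ^ g m := by
  induction d with
  | zero => exact Summable.of_finite
  | succ d ih =>
    rw [← (Fin.consEquiv fun _ => ℕ).summable_iff]
    refine ((summable_geometric_of_lt_one hx0 hx1).mul_of_nonneg ih (fun n => by positivity)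
      fun g => Finset.prod_nonneg fun m _ => by positivity).congr fun g => ?_
    simp [Fin.prod_univ_succ, Fin.consEquiv]

lemma exists_norm_chainTerm_le {q : ℂ} (hq1 : ‖q‖ < 1) (d : ℕ) :
    ∃ K : ℝ, ∀ (p L : ℕ) (g : Fin d → ℕ), ‖chainTerm q d p L g‖ ≤ K * ∏ m, ‖q‖ ^ g m := by
  obtain ⟨C, hC, hI⟩ := exists_norm_invPoch_le hq1
  refine ⟨C ^ (d + 1), ?_⟩
  induction d with
  | zero => intro p L g; simpa [chainTerm] using hI L
  | succ d ih =>
    intro p L g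
    rw [chainTerm, norm_mul, norm_mul, norm_pow, Fin.prod_univ_succ]
    have h1 : ‖q‖ ^ (g 0 ^ 2 + if p = 0 then g 0 else 0) ≤ ‖q‖ ^ g 0 :=
      pow_le_pow_of_le_one (norm_nonneg q) hq1.le ((Nat.le_self_pow two_ne_zero _).trans (Nat.le_add_right _ _))
    calc _ ≤ ‖q‖ ^ g 0 * C * (C ^ (d + 1) * ∏ m, ‖q‖ ^ Fin.tail g m) := by
          gcongr
          · exact hI _
          · exact ih _ _ _
      _ = _ := by simp only [Fin.tail]; ring

lemma tsum_fin_succ {d : ℕ} {F : ℕ → (Fin d → ℕ) → ℂ} (hF : Summable (Function.uncurry F)) :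
    ∑' f : Fin (d + 1) → ℕ, F (f 0) (Fin.tail f) = ∑' n, ∑' g, F n g :=
  ((Fin.consEquiv fun _ : Fin (d + 1) => ℕ).symm.tsum_eq (Function.uncurry F)).trans hF.tsum_prod

lemma tsum_chainTerm {q : ℂ} (hq1 : ‖q‖ < 1) (d p L : ℕ) :
    ∑' g : Fin d → ℕ, chainTerm q d p L g = chainSum q d p L := by
  induction d generalizing p L with
  | zero => simp [chainTerm, chainSum]
  | succ d ih =>
    have hs : Summable fun g : Fin (d + 1) → ℕ => chainTerm q (d + 1) p L g := by
      obtain ⟨K, hK⟩ := exists_norm_chainTerm_le hq1 (d + 1)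
      exact .of_norm_bounded ((summable_prod_pow (norm_nonneg q) hq1 (d + 1)).mul_left K)
        fun g => hK p L g
    refine (tsum_fin_succ ((Fin.consEquiv fun _ : Fin (d + 1) => ℕ).symm.summable_iff.mp hs :
      Summable (Function.uncurry fun (n : ℕ) g => q ^ (n ^ 2 + if p = 0 then n else 0) *
        invPoch q (L - n) * chainTerm q d (p - 1) n g))).trans ?_
    simp only [tsum_mul_left, ih, chainSum]
    refine tsum_eq_sum fun n hn => ?_
    rw [invPoch_of_neg q (n := (L : ℤ) - n) (by simp at hn; lia)]; ring

lemma antitone_cons_cons_iff {d : ℕ} (L n : ℕ) (h : Fin d → ℕ) :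
    Antitone (Fin.cons L (Fin.cons n h : Fin (d + 1) → ℕ) : Fin (d + 2) → ℕ) ↔
      n ≤ L ∧ Antitone (Fin.cons n h : Fin (d + 1) → ℕ) := by
  rw [Fin.antitone_iff_succ_le, Fin.antitone_iff_succ_le, Fin.forall_fin_succ]
  simp

lemma chainTerm_eq (q : ℂ) (d p L : ℕ) (g : Fin d → ℕ) :
    chainTerm q d p L g =
      if Antitone (Fin.cons L g : Fin (d + 1) → ℕ) then
        q ^ ((∑ m, g m ^ 2) + ∑ m : Fin d, if p ≤ m.val then g m else 0) /
          ((∏ m : Fin d, qPochN q q ((Fin.cons L g : Fin (d + 1) → ℕ) m.castSucc -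
              (Fin.cons L g : Fin (d + 1) → ℕ) m.succ)) *
            qPochN q q ((Fin.cons L g : Fin (d + 1) → ℕ) (Fin.last d)))
      else 0 := by
  induction d generalizing p L with
  | zero =>
    rw [if_pos (Fin.antitone_iff_succ_le.mpr fun i => i.elim0)]
    simp [chainTerm, invPoch_natCast]
  | succ d ih =>
    obtain ⟨n, h, rfl⟩ : ∃ n h, g = Fin.cons n h := ⟨g 0, Fin.tail g, (Fin.cons_self_tail g).symm⟩
    rw [chainTerm, ih, Fin.cons_zero, Fin.tail_cons]
    simp only [antitone_cons_cons_iff]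
    rcases lt_or_ge L n with hL | hL
    · rw [invPoch_of_neg q (by lia), if_neg fun hA : n ≤ L ∧ _ => hL.not_ge hA.1]; ring
    · by_cases hA : Antitone (Fin.cons n h : Fin (d + 1) → ℕ)
      · simp only [hA, hL, and_true, if_true, ← Nat.cast_sub hL, invPoch_natCast]
        simp only [Fin.sum_univ_succ, Fin.prod_univ_succ, Fin.cons_zero, Fin.cons_succ,
          Fin.castSucc_zero, ← Fin.succ_castSucc, ← Fin.succ_last, Fin.val_zero, Fin.val_succ,
          tsub_le_iff_right, nonpos_iff_eq_zero, pow_add, div_eq_mul_inv, mul_inv]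
        ring
      · simp only [hA, and_false, if_false, mul_zero]

/-! ### The outermost sum -/

lemma summable_norm_prod_of_tendsto_zero {u : ℕ → ℂ} (hu : Tendsto u atTop (𝓝 0)) :
    Summable fun n : ℕ => ‖∏ j ∈ Finset.range n, u j‖ := by
  refine summable_of_ratio_norm_eventually_le (r := 1 / 2) (by norm_num) ?_
  have := (tendsto_zero_iff_norm_tendsto_zero.mp hu).eventually (gt_mem_nhds one_half_pos)
  filter_upwards [this] with n hn
  rw [Finset.prod_range_succ, norm_mul, norm_mul, mul_comm (1 / 2 : ℝ), norm_norm, norm_norm]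
  gcongr

lemma tendsto_invPoch_add {q : ℂ} (hq1 : ‖q‖ < 1) (c : ℤ) :
    Tendsto (fun n : ℕ => invPoch q (n + c)) atTop (𝓝 (qPochInf q q)⁻¹) := by
  have h : Tendsto (invPoch q) atTop (𝓝 (qPochInf q q)⁻¹) := by
    rw [← Nat.map_cast_int_atTop, tendsto_map'_iff]
    exact tendsto_invPoch hq1
  exact h.comp (tendsto_atTop_add_const_right _ c tendsto_natCast_atTop_atTop)

/-- The limiting case of the `q`-Gauss sum. -/
lemma tsum_qGauss {q : ℂ} (hq0 : q ≠ 0) (hq1 : ‖q‖ < 1) (y : ℂ) (C : ℤ) :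
    ∑' m : ℕ, (∏ i ∈ Finset.range m, q ^ i * (q ^ (C + 1 + i) - y)) *
      (invPoch q m * invPoch q (m + C)) = qPochInf y q / qPochInf q q := by
  obtain ⟨K, hK, hI⟩ := exists_norm_invPoch_le hq1
  have hpow : Tendsto (fun i : ℕ => q ^ i) atTop (𝓝 0) :=
    tendsto_pow_atTop_nhds_zero_of_norm_lt_one hq1
  have hu : Tendsto (fun i : ℕ => q ^ i * (q ^ (C + 1 + i) - y)) atTop (𝓝 0) := by
    simp only [zpow_add₀ hq0 _ (Nat.cast _), zpow_natCast]
    simpa using hpow.mul ((hpow.const_mul (q ^ (C + 1))).sub_const y)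
  have lim := tendsto_tsum_of_dominated_convergence (𝓕 := atTop)
    (f := fun (M m : ℕ) => (∏ i ∈ Finset.range m, q ^ i * (q ^ (C + 1 + i) - y)) *
      (invPoch q (M - m) * invPoch q m * invPoch q (m + C)))
    (g := fun m : ℕ => (∏ i ∈ Finset.range m, q ^ i * (q ^ (C + 1 + i) - y)) *
      ((qPochInf q q)⁻¹ * invPoch q m * invPoch q (m + C)))
    ((summable_norm_prod_of_tendsto_zero hu).mul_right (K * K * K))
    (fun m => (((tendsto_invPoch_add hq1 (-m)).mul_const _).mul_const _).const_mul _)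
    (Eventually.of_forall fun M m => by
      rw [norm_mul, norm_mul, norm_mul]
      gcongr <;> exact hI _)
  have fin : ∀ M : ℕ, ∑' m : ℕ, (∏ i ∈ Finset.range m, q ^ i * (q ^ (C + 1 + i) - y)) *
      (invPoch q (M - m) * invPoch q m * invPoch q (m + C)) =
      qPochN y q M * invPoch q M * invPoch q (M + C) := fun M => by
    rw [← sum_qGauss hq0 hq1]
    refine tsum_eq_sum fun m hm => ?_
    rw [invPoch_of_neg q (n := (M : ℤ) - m) (by simp at hm; lia)]; ring
  simp only [fin] at lim
  have key := tendsto_nhds_unique lim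
    (((tendsto_qPochN hq1 y).mul (tendsto_invPoch hq1)).mul (tendsto_invPoch_add hq1 C))
  have hne := qPochInf_self_ne_zero hq1
  simp only [mul_assoc, mul_left_comm _ (qPochInf q q)⁻¹, tsum_mul_left] at key
  rw [mul_left_cancel₀ (inv_ne_zero hne) key, div_eq_mul_inv]

lemma weight_eq_prod {a : ℂ} (ha : a ≠ 0) (q : ℂ) (n : ℕ) :
    q ^ (n * (n + 1) / 2) * qPochN (-(1 / a)) q n * a ^ n =
      ∏ j ∈ Finset.range n, q ^ (j + 1) * (a + q ^ j) := by
  induction n with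
  | zero => simp [qPochN]
  | succ n ih =>
    have h1 : (n + 1) * (n + 1 + 1) / 2 = n * (n + 1) / 2 + (n + 1) := by
      rw [show (n + 1) * (n + 1 + 1) = n * (n + 1) + 2 * (n + 1) by ring,
        Nat.add_mul_div_left _ _ two_pos]
    have h2 : qPochN (-(1 / a)) q (n + 1) = qPochN (-(1 / a)) q n * (1 - -(1 / a) * q ^ n) :=
      Finset.prod_range_succ ..
    rw [Finset.prod_range_succ, ← ih, h1, h2, pow_add]
    field_simp
    ring

/-- The weight `q ^ (r (r + 1) / 2) a ^ r (-1/a;q)_r` for an arbitrary integer `r`. -/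
noncomputable def weightZ (q a : ℂ) (r : ℤ) : ℂ :=
  q ^ (r + r * (r - 1) / 2) * a ^ r * qPochZ (-(1 / a)) q r

lemma weightZ_add_one {q a : ℂ} (hq0 : q ≠ 0) (hq1 : ‖q‖ < 1) (ha : a ≠ 0)
    (haq : ∀ r : ℤ, a + q ^ r ≠ 0) (r : ℤ) :
    weightZ q a (r + 1) = weightZ q a r * (q ^ (r + 1) * (a + q ^ r)) := by
  have h1 := two_mul_tri r
  have h2 := two_mul_tri (r + 1)
  have h3 : (r + 1) * (r + 1 - 1) / 2 = r * (r - 1) / 2 + r := by linarith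
  have hne : 1 - -(1 / a) * q ^ r ≠ 0 := by
    rw [show 1 - -(1 / a) * q ^ r = (a + q ^ r) / a by field_simp; ring]
    exact div_ne_zero (haq r) ha
  have h4 : qPochZ (-(1 / a)) q (r + 1) = qPochZ (-(1 / a)) q r * (1 - -(1 / a) * q ^ r) := by
    rw [qPochZ, qPochZ, qPochInf_eq_mul hq1 (-(1 / a) * q ^ r), zpow_add_one₀ hq0, ← mul_assoc,
      ← div_div, div_right_comm, div_mul_cancel₀ _ hne]
  rw [weightZ, weightZ, h3, h4, zpow_add_one₀ ha,
    show r + 1 + (r * (r - 1) / 2 + r) = (r + r * (r - 1) / 2) + (r + 1) by ring,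
    zpow_add₀ hq0 (r + _)]
  field_simp
  ring

lemma weightZ_add_natCast {q a : ℂ} (hq0 : q ≠ 0) (hq1 : ‖q‖ < 1) (ha : a ≠ 0)
    (haq : ∀ r : ℤ, a + q ^ r ≠ 0) (r : ℤ) (m : ℕ) :
    weightZ q a (r + m) =
      weightZ q a r * ∏ i ∈ Finset.range m, q ^ (r + i + 1) * (a + q ^ (r + i)) := by
  induction m with
  | zero => simp
  | succ m ih =>
    rw [Finset.prod_range_succ, ← mul_assoc, ← ih, ← weightZ_add_one hq0 hq1 ha haq]
    congr 1; push_cast; ring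

lemma weightZ_natCast {q a : ℂ} (hq0 : q ≠ 0) (hq1 : ‖q‖ < 1) (ha : a ≠ 0)
    (haq : ∀ r : ℤ, a + q ^ r ≠ 0) (n : ℕ) :
    weightZ q a n = ∏ j ∈ Finset.range n, q ^ (j + 1) * (a + q ^ j) := by
  have h := weightZ_add_natCast hq0 hq1 ha haq 0 n
  have hne : qPochInf (-(1 / a)) q ≠ 0 := by
    refine qPochInf_ne_zero hq1 fun i => ?_
    rw [show 1 - -(1 / a) * q ^ i = (a + q ^ (i : ℤ)) / a by rw [zpow_natCast]; field_simp; ring]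
    exact div_ne_zero (haq i) ha
  have h0 : weightZ q a 0 = 1 := by simpa [weightZ, qPochZ] using div_self hne
  rw [h0, one_mul, zero_add] at h
  rw [h]
  refine Finset.prod_congr rfl fun j _ => ?_
  rw [zero_add, zpow_natCast, ← zpow_natCast q (j + 1)]
  push_cast
  rfl

lemma tsum_weight {q a : ℂ} (hq0 : q ≠ 0) (hq1 : ‖q‖ < 1) (ha : a ≠ 0)
    (haq : ∀ r : ℤ, a + q ^ r ≠ 0) (r : ℤ) :
    ∑' n : ℕ, (∏ j ∈ Finset.range n, q ^ (j + 1) * (a + q ^ j)) *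
        (invPoch q (n - r) * invPoch q (n + r)) =
      weightZ q a r * (qPochInf (-(a * q) * q ^ r) q / qPochInf q q) := by
  simp only [← weightZ_natCast hq0 hq1 ha haq]
  rw [← tsum_int_eq_tsum_nat
    (f := fun n : ℤ => weightZ q a n * (invPoch q (n - r) * invPoch q (n + r))),
    ← (Equiv.addRight r).tsum_eq]
  · simp only [Equiv.coe_addRight, add_sub_cancel_right]
    rw [tsum_int_eq_tsum_nat fun m hm => by rw [invPoch_of_neg q hm]; ring,
      ← tsum_qGauss hq0 hq1 _ (2 * r), ← tsum_mul_left]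
    refine tsum_congr fun m => ?_
    rw [add_comm (m : ℤ) r, weightZ_add_natCast hq0 hq1 ha haq,
      show r + m + r = m + 2 * r by ring, mul_assoc]
    congr 2
    refine Finset.prod_congr rfl fun i _ => ?_
    rw [show (2 * r + 1 + i : ℤ) = r + r + 1 + i by ring]
    simp only [zpow_add₀ hq0, zpow_natCast, zpow_one]
    ring
  · intro n hn
    rcases lt_or_ge n r with h | h
    · rw [invPoch_of_neg q (n := n - r) (by lia)]; ring
    · rw [invPoch_of_neg q (n := n + r) (by lia)]; ring

lemma summable_pow_natAbs {x : ℝ} (hx0 : 0 ≤ x) (hx1 : x < 1) :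
    Summable fun r : ℤ => x ^ r.natAbs :=
  .of_nat_of_neg (by simpa using summable_geometric_of_lt_one hx0 hx1)
    (by simpa using summable_geometric_of_lt_one hx0 hx1)

lemma tendsto_pow_mul_add {q : ℂ} (hq1 : ‖q‖ < 1) (a : ℂ) :
    Tendsto (fun j : ℕ => q ^ j * (a + q ^ j)) atTop (𝓝 0) := by
  have hpow : Tendsto (fun i : ℕ => q ^ i) atTop (𝓝 0) :=
    tendsto_pow_atTop_nhds_zero_of_norm_lt_one hq1
  simpa using hpow.mul (hpow.const_add a)

lemma prod_weight_eq (q a : ℂ) (n : ℕ) :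
    ∏ j ∈ Finset.range n, q ^ (j + 1) * (a + q ^ j) =
      q ^ n * ∏ j ∈ Finset.range n, q ^ j * (a + q ^ j) := by
  have : q ^ n = ∏ _j ∈ Finset.range n, q := by simp
  rw [this, ← Finset.prod_mul_distrib]
  exact Finset.prod_congr rfl fun j _ => by ring

lemma tsum_weight_mul_bailey {q a : ℂ} (hq0 : q ≠ 0) (hq1 : ‖q‖ < 1) (ha : a ≠ 0)
    (haq : ∀ r : ℤ, a + q ^ r ≠ 0) {A : ℤ → ℂ} (hA : ∀ r, ‖A r‖ ≤ 1) :
    ∑' n : ℕ, (∏ j ∈ Finset.range n, q ^ (j + 1) * (a + q ^ j)) * bailey q 0 A n =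
      ∑' r : ℤ, A r * (weightZ q a r * (qPochInf (-(a * q) * q ^ r) q / qPochInf q q)) := by
  simp only [bailey, ← tsum_mul_left, ← tsum_weight hq0 hq1 ha haq, add_zero]
  refine (Summable.tsum_comm ?_).symm.trans (tsum_congr fun r => tsum_congr fun n => by ring)
  obtain ⟨K, hK, hI⟩ := exists_norm_invPoch_le hq1
  have hw := (summable_norm_prod_of_tendsto_zero (tendsto_pow_mul_add hq1 a)).mul_right (K * K)
  refine .of_norm_bounded (hw.mul_of_nonneg (summable_pow_natAbs (norm_nonneg q) hq1)
    (fun n => by positivity) fun r => by positivity) fun ⟨n, r⟩ => ?_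
  simp only [Function.uncurry_apply_pair]
  rcases le_or_gt r.natAbs n with h | h
  · rw [prod_weight_eq, norm_mul, norm_mul, norm_mul, norm_mul, norm_pow]
    have h1 : ‖q‖ ^ n ≤ ‖q‖ ^ r.natAbs := pow_le_pow_of_le_one (norm_nonneg q) hq1.le h
    calc _ ≤ ‖q‖ ^ r.natAbs * ‖∏ j ∈ Finset.range n, q ^ j * (a + q ^ j)‖ * (1 * (K * K)) := by
          gcongr
          · exact hA r
          · exact hI _
          · exact hI _
      _ = _ := by ring
  · have : invPoch q (n - r) * invPoch q (n + r) = 0 := by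
      rcases le_or_gt 0 r with hr | hr
      · rw [invPoch_of_neg q (n := n - r) (by lia), zero_mul]
      · rw [invPoch_of_neg q (n := n + r) (by lia), mul_zero]
    rw [this, mul_zero, mul_zero, norm_zero]
    positivity

lemma norm_gordonCoeff_le_one {q : ℂ} (hq1 : ‖q‖ < 1) {D e : ℤ} (hD : 0 ≤ D) (he : 0 ≤ e)
    (heD : e ≤ D + 1) (r : ℤ) : ‖gordonCoeff q D e r‖ ≤ 1 := by
  have h := two_mul_tri r
  have hexp : 0 ≤ D * r ^ 2 + e * r + r * (r - 1) / 2 := by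
    rcases le_or_gt 0 r with hr | hr
    · have h1 : 0 ≤ r * (r - 1) := by
        rcases hr.eq_or_lt with rfl | hr
        · simp
        · exact mul_nonneg hr.le (by lia)
      have h2 : 0 ≤ r * (r - 1) / 2 := by lia
      positivity
    · have h1 : 0 ≤ (2 * D + 1) * (r * (r + 1)) :=
        mul_nonneg (by lia) (mul_nonneg_of_nonpos_of_nonpos hr.le (by lia))
      have h2 : 0 ≤ (D + 1 - e) * (-r) := mul_nonneg (by lia) (by lia)
      nlinarith
  obtain ⟨N, hN⟩ := Int.eq_ofNat_of_zero_le hexp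
  rw [gordonCoeff, hN, norm_mul, norm_zpow, norm_neg, norm_one, one_zpow, one_mul, zpow_natCast,
    norm_pow]
  exact pow_le_one₀ (norm_nonneg q) hq1.le

lemma tsum_weight_mul_chainTerm {q : ℂ} (hq1 : ‖q‖ < 1) (a : ℂ) (d p c : ℕ) :
    ∑' f : Fin (d + 1) → ℕ, (∏ j ∈ Finset.range (f 0), q ^ (j + 1) * (a + q ^ j)) *
        (q ^ (c * f 0) * chainTerm q d p (f 0) (Fin.tail f)) =
      ∑' n : ℕ, (∏ j ∈ Finset.range n, q ^ (j + 1) * (a + q ^ j)) *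
        (q ^ (c * n) * chainSum q d p n) := by
  rw [tsum_fin_succ (F := fun n g => (∏ j ∈ Finset.range n, q ^ (j + 1) * (a + q ^ j)) *
    (q ^ (c * n) * chainTerm q d p n g))]
  · simp only [tsum_mul_left, tsum_chainTerm hq1]
  obtain ⟨K, hK⟩ := exists_norm_chainTerm_le hq1 d
  have hw := summable_norm_prod_of_tendsto_zero (tendsto_pow_mul_add hq1 a)
  have hg := (summable_prod_pow (norm_nonneg q) hq1 d).mul_left K
  refine .of_norm_bounded (hw.mul_of_nonneg hg (fun n => by positivity) fun g => ?_) fun ⟨n, g⟩ => ?_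
  · exact (norm_nonneg _).trans (hK p 0 g)
  · have h1 : ‖q‖ ^ n ≤ 1 := pow_le_one₀ (norm_nonneg q) hq1.le
    have h2 : ‖q‖ ^ (c * n) ≤ 1 := pow_le_one₀ (norm_nonneg q) hq1.le
    simp only [Function.uncurry_apply_pair, prod_weight_eq, norm_mul, norm_pow]
    calc _ ≤ 1 * ‖∏ j ∈ Finset.range n, q ^ j * (a + q ^ j)‖ *
            (1 * (K * ∏ m, ‖q‖ ^ g m)) := by
          gcongr
          exact hK p n g
      _ = _ := by simp

/-- **Equation (6.1)/(6.2).** The multiple series for the Durfee dissection equals the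
generating function of Theorem 1.5. -/
theorem multisum_eq_gen_fun (k i : ℕ) (hk : 2 ≤ k) (hi : 1 ≤ i) (hik : i ≤ k) (a q : ℂ)
    (hq0 : 0 < ‖q‖) (hq1 : ‖q‖ < 1) (ha : a ≠ 0)
    (hpoch : ∀ m : ℤ, qPochZ (-(a * q)) q m ≠ 0) :
    ∑' f : Fin (k - 1) → ℕ,
      (if ∀ m l : Fin (k - 1), m ≤ l → f l ≤ f m then
        q ^ (f ⟨0, by omega⟩ * (f ⟨0, by omega⟩ + 1) / 2 +
            (∑ m : Fin (k - 1), if 1 ≤ m.val then (f m) ^ 2 else 0) +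
            (∑ m : Fin (k - 1), if i - 1 ≤ m.val then f m else 0)) *
          qPochN (-(1 / a)) q (f ⟨0, by omega⟩) * a ^ (f ⟨0, by omega⟩) /
          ((∏ m : Fin (k - 2),
              qPochN q q (f (Fin.cast (by omega) m.castSucc) - f (Fin.cast (by omega) m.succ))) *
            qPochN q q (f ⟨k - 2, by omega⟩))
      else 0) =
      qPochInf (-(a * q)) q / qPochInf q q *
        ∑' n : ℤ, (-1 : ℂ) ^ n * a ^ n *
          q ^ ((k : ℤ) * n ^ 2 + ((k : ℤ) - (i : ℤ) + 1) * n) *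
          (qPochZ (-(1 / a)) q n / qPochZ (-(a * q)) q n) := by
  have hq : q ≠ 0 := norm_pos_iff.mp hq0
  have hinf : ∀ m : ℤ, qPochInf (-(a * q) * q ^ m) q ≠ 0 := 
    fun m h => hpoch m (by rw [qPochZ, h, div_zero])
  have hinf0 : qPochInf (-(a * q)) q ≠ 0 := by simpa using hinf 0
  have haq : ∀ r : ℤ, a + q ^ r ≠ 0 := by
    intro r h
    apply hinf (-r - 1)
    rw [qPochInf_eq_mul hq1, show a = -q ^ r by linear_combination h]
    have : (-(-q ^ r * q) * q ^ (-r - 1) : ℂ) = 1 := by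
      rw [neg_mul, neg_mul, neg_mul, neg_neg, ← zpow_add_one₀ hq, ← zpow_add₀ hq]
      simp
    rw [this]; ring
  obtain ⟨d, rfl⟩ : ∃ d, k = d + 2 := ⟨k - 2, by lia⟩
  have term_eq : ∀ f : Fin (d + 1) → ℕ,
      (if ∀ m l : Fin (d + 1), m ≤ l → f l ≤ f m then
        q ^ (f 0 * (f 0 + 1) / 2 + (∑ m : Fin (d + 1), if 1 ≤ m.val then (f m) ^ 2 else 0) +
            (∑ m : Fin (d + 1), if i - 1 ≤ m.val then f m else 0)) *
          qPochN (-(1 / a)) q (f 0) * a ^ (f 0) /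
          ((∏ m : Fin d, qPochN q q (f m.castSucc - f m.succ)) * qPochN q q (f (Fin.last d)))
      else 0) =
      (∏ j ∈ Finset.range (f 0), q ^ (j + 1) * (a + q ^ j)) *
        (q ^ ((if i = 1 then 1 else 0) * f 0) * chainTerm q d (i - 2) (f 0) (Fin.tail f)) := by
    intro f
    rw [chainTerm_eq, Fin.cons_self_tail, ← weight_eq_prod ha]
    have hanti : (∀ m l : Fin (d + 1), m ≤ l → f l ≤ f m) ↔ Antitone f := Iff.rfl
    have hexp : ∀ m : Fin d, i - 1 ≤ m.val + 1 ↔ i - 2 ≤ m.val := fun m => by lia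
    have hi1 : i - 1 = 0 ↔ i = 1 := by lia
    simp only [hanti]
    by_cases hA : Antitone f
    · simp only [hA, if_true, Fin.sum_univ_succ, Fin.tail, Fin.val_zero, Fin.val_succ, hexp, hi1,
        nonpos_iff_eq_zero, one_ne_zero, if_false, le_add_iff_nonneg_left, zero_le, pow_add,
        ite_mul, one_mul, zero_mul, zero_add]
      ring
    · simp only [hA, if_false, mul_zero]
  refine (tsum_congr term_eq).trans ?_
  refine (tsum_weight_mul_chainTerm hq1 a d _ _).trans ?_
  have inner : ∀ n : ℕ, q ^ ((if i = 1 then 1 else 0) * n) * chainSum q d (i - 2) n =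
      bailey q 0 (gordonCoeff q (d + 1) (d + 3 - i)) n := by
    intro n
    rcases hi.eq_or_lt with rfl | hi2
    · have := bailey_zero_gordonCoeff_succ hq hq1 (d + 1) n
      rw [if_pos rfl, one_mul, chainSum_zero_right hq hq1, ← this]
      congr 2; push_cast; ring
    · rw [if_neg hi2.ne', zero_mul, pow_zero, one_mul,
        chainSum_eq_bailey hq hq1 (by lia : i - 2 ≤ d)]
      congr 2; lia
  simp only [inner]
  rw [tsum_weight_mul_bailey hq hq1 ha haq
    (norm_gordonCoeff_le_one hq1 (by lia) (by lia) (by lia)), ← tsum_mul_left]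
  refine tsum_congr fun r => ?_
  have hexp : (((d + 2 : ℕ) : ℤ) * r ^ 2 + (((d + 2 : ℕ) : ℤ) - i + 1) * r) =
      ((d + 1) * r ^ 2 + (d + 3 - i) * r + r * (r - 1) / 2) + (r + r * (r - 1) / 2) := by
    push_cast
    linear_combination -(two_mul_tri r)
  have hr := hinf r
  have hself := qPochInf_self_ne_zero hq1
  rw [hexp, zpow_add₀ hq (_ + _ + _), gordonCoeff, weightZ, qPochZ.eq_def (-(a * q))]
  field_simp

end Paper
end

section
/- For integers 1 ≤ i ≤ k−1 and every positive integer n, B̄_{k,i}(n) + B̄_{k,i+1}(n) equals the number of superpartitions of n whose non-overlined parts are not congruent to 0 or ±i modulo 2k. -/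
namespace Paper

/-- An overpartition is represented as a list of pairs `(part, overlined?)`.
Parts are positive, the list is non-increasing in the part sizes, and among
equal parts only the final occurrence may be overlined. -/
def IsOverpartition (l : List (ℕ × Bool)) : Prop :=
  (∀ p ∈ l, 1 ≤ p.1) ∧
  l.Chain' fun x y => y.1 < x.1 ∨ (x.1 = y.1 ∧ x.2 = false)

/-- The weight of an overpartition: the sum of its parts. -/
def opWeight (l : List (ℕ × Bool)) : ℕ := (l.map Prod.fst).sum

/-- The number of overlined parts. -/
def opOverlined (l : List (ℕ × Bool)) : ℕ := (l.filter fun p => p.2).length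

/-- The difference condition of Gordon type: `λ_ℓ - λ_{ℓ+k-1} ≥ 1` if `λ_{ℓ+k-1}` is
overlined and `λ_ℓ - λ_{ℓ+k-1} ≥ 2` otherwise (indices `0`-based). -/
def GapCond (k : ℕ) (l : List (ℕ × Bool)) : Prop :=
  ∀ m : ℕ, m + (k - 1) < l.length →
    (l.getD (m + (k - 1)) (0, false)).1 +
      (if (l.getD (m + (k - 1)) (0, false)).2 then 1 else 2) ≤ (l.getD m (0, false)).1

/-- Overpartitions counted by `B̄_{k,i}`: the Gordon difference condition holds and at
most `i - 1` parts are equal to `1`. -/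
def BCond (k i : ℕ) (l : List (ℕ × Bool)) : Prop :=
  IsOverpartition l ∧ GapCond k l ∧ (l.filter fun p => p.1 == 1).length ≤ i - 1

/-- `Bbar k i n j` : the number of overpartitions of `n` with `j` overlined parts
satisfying the `B̄_{k,i}` conditions. -/
noncomputable def Bbar (k i n j : ℕ) : ℕ :=
  Nat.card {l : List (ℕ × Bool) //
    BCond k i l ∧ opWeight l = n ∧ opOverlined l = j}

/-- The Frobenius representation of an overpartition: a two-rowed array whose top row
is a partition into distinct nonnegative parts and whose bottom row is an
overpartition into nonnegative parts where the first occurrence of a part may be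
overlined. -/
structure FrobSym : Type where
  top : List ℕ
  bot : List (ℕ × Bool)
  top_sorted : top.Chain' (· > ·)
  bot_sorted : bot.Chain' fun x y => y.1 < x.1 ∨ (x.1 = y.1 ∧ y.2 = false)
  len_eq : top.length = bot.length

/-- The number of columns of a Frobenius symbol. -/
def frobCols (F : FrobSym) : ℕ := F.top.length

/-- The weight of the overpartition represented by a Frobenius symbol. -/
def frobWeight (F : FrobSym) : ℕ :=
  F.top.length + F.top.sum + (F.bot.map Prod.fst).sum

/-- The number of non-overlined parts in the bottom row. -/
def botNonOverlined (F : FrobSym) : ℕ := (F.bot.filter fun p => !p.2).length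

/-- The number of overlined parts in the bottom row. -/
def botOverlined (F : FrobSym) : ℕ := (F.bot.filter fun p => p.2).length

/-- The `m`-th successive rank (0-based): `a_m - b_m` minus the number of
non-overlined parts among `b_{m+1}, …, b_N`. -/
def frobRank (F : FrobSym) (m : ℕ) : ℤ :=
  (F.top.getD m 0 : ℤ) - ((F.bot.getD m (0, false)).1 : ℤ) -
    (((F.bot.drop (m + 1)).filter fun p => !p.2).length : ℤ)

/-- All successive ranks lie in the interval `[-i+2, 2k-i-1]`. -/
def RankCond (k i : ℕ) (F : FrobSym) : Prop :=
  ∀ m : ℕ, m < F.top.length →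
    -(i : ℤ) + 2 ≤ frobRank F m ∧ frobRank F m ≤ 2 * (k : ℤ) - i - 1

/-- `Cbar k i n j` : the number of overpartitions of `n` (counted through their
Frobenius representation) with `j` non-overlined parts in the bottom row and all
successive ranks in `[-i+2, 2k-i-1]`. -/
noncomputable def Cbar (k i n j : ℕ) : ℕ :=
  Nat.card {F : FrobSym //
    frobWeight F = n ∧ botNonOverlined F = j ∧ RankCond k i F}

/-- The list of overlined parts (in order). -/
def olList (l : List (ℕ × Bool)) : List ℕ := (l.filter fun p => p.2).map Prod.fst

/-- The list of non-overlined parts (in order). -/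
def nolList (l : List (ℕ × Bool)) : List ℕ := (l.filter fun p => !p.2).map Prod.fst

/-- The size of the generalized Durfee square: the largest `N` such that the number of
overlined parts plus the number of non-overlined parts `≥ N` is at least `N`. -/
noncomputable def genDurfeeSize (l : List (ℕ × Bool)) : ℕ :=
  Nat.findGreatest
    (fun N => N ≤ (olList l).length + ((nolList l).filter fun p => decide (N ≤ p)).length)
    l.length

/-- The size of the generalized Durfee rectangle: the largest `N` such that the number
of overlined parts plus the number of non-overlined parts `≥ N + 1` is at least `N`. -/
noncomputable def genDurfeeRectSize (l : List (ℕ × Bool)) : ℕ :=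
  Nat.findGreatest
    (fun N => N ≤ (olList l).length + ((nolList l).filter fun p => decide (N + 1 ≤ p)).length)
    l.length

/-- The (ordinary) partition lying below the first generalized Durfee square/rectangle
of size `N`, when the overlined parts are displayed above the non-overlined ones. -/
def belowGen (l : List (ℕ × Bool)) (N : ℕ) : List ℕ :=
  (nolList l).drop (N - (olList l).length)

/-- The size of the Durfee square of an ordinary partition. -/
noncomputable def durfeeSquareSize (μ : List ℕ) : ℕ :=
  Nat.findGreatest (fun d => d ≤ (μ.filter fun p => decide (d ≤ p)).length) μ.length

/-- The size of the `d × (d+1)` Durfee rectangle of an ordinary partition. -/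
noncomputable def durfeeRectSize (μ : List ℕ) : ℕ :=
  Nat.findGreatest (fun d => d ≤ (μ.filter fun p => decide (d + 1 ≤ p)).length) μ.length

/-- Remove `m` successive Durfee squares. -/
noncomputable def dissectSquares : ℕ → List ℕ → List ℕ
  | 0, μ => μ
  | m + 1, μ => dissectSquares m (μ.drop (durfeeSquareSize μ))

/-- Remove `m` successive Durfee rectangles. -/
noncomputable def dissectRects : ℕ → List ℕ → List ℕ
  | 0, μ => μ
  | m + 1, μ => dissectRects m (μ.drop (durfeeRectSize μ))

/-- The overpartition has `i - 1` successive Durfee squares followed by `k - i`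
successive Durfee rectangles, the first one being a generalized
Durfee square (if `i ≥ 2`) or a generalized Durfee rectangle (if `i = 1`). -/
noncomputable def DurfeeCond (k i : ℕ) (l : List (ℕ × Bool)) : Prop :=
  if 2 ≤ i then
    dissectRects (k - i) (dissectSquares (i - 2) (belowGen l (genDurfeeSize l))) = []
  else
    dissectRects (k - 2) (belowGen l (genDurfeeRectSize l)) = []

/-- `Dbar k i n j` : the number of overpartitions of `n` with `j` overlined parts and
`i-1` successive Durfee squares followed by `k-i` successive Durfee rectangles, the
first one being a generalized Durfee square/rectangle. -/
noncomputable def Dbar (k i n j : ℕ) : ℕ :=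
  Nat.card {l : List (ℕ × Bool) //
    IsOverpartition l ∧ opWeight l = n ∧ opOverlined l = j ∧ DurfeeCond k i l}


/-- A superpartition: a non-increasing sequence of nonnegative integers in which the
first occurrence of a part may be overlined (so the part `0̄` may appear). -/
def IsSuperpartition (l : List (ℕ × Bool)) : Prop :=
  (∀ p ∈ l, 1 ≤ p.1 ∨ p.2 = true) ∧
  l.Chain' fun x y => y.1 < x.1 ∨ (x.1 = y.1 ∧ y.2 = false)

section GeneratingFunctions

open PowerSeries

/-- The block of parts equal to `v` in an overpartition: `f` non-overlined copies, followed by an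
overlined one if `b` holds. -/
def partBlock (v f : ℕ) (b : Bool) : List (ℕ × Bool) :=
  List.replicate f (v, false) ++ if b then [(v, true)] else []

lemma length_partBlock (v f : ℕ) (b : Bool) : (partBlock v f b).length = f + b.toNat := by
  cases b <;> simp [partBlock]

lemma fst_of_mem_partBlock {v f : ℕ} {b : Bool} {p : ℕ × Bool} (hp : p ∈ partBlock v f b) :
    p.1 = v := by
  cases b <;> simp [partBlock] at hp <;> grind

lemma opWeight_append (l₁ l₂ : List (ℕ × Bool)) :
    opWeight (l₁ ++ l₂) = opWeight l₁ + opWeight l₂ := by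
  simp [opWeight]

lemma opWeight_partBlock (v f : ℕ) (b : Bool) :
    opWeight (partBlock v f b) = v * (f + b.toNat) := by
  cases b <;> simp [opWeight, partBlock] <;> ring

lemma IsOverpartition.pairwise {l : List (ℕ × Bool)} (h : IsOverpartition l) :
    l.Pairwise fun x y => y.1 < x.1 ∨ (x.1 = y.1 ∧ x.2 = false) := by
  have : IsTrans (ℕ × Bool) fun x y => y.1 < x.1 ∨ (x.1 = y.1 ∧ x.2 = false) :=
    ⟨by intro a b c; grind⟩
  exact List.isChain_iff_pairwise.1 h.2

lemma isOverpartition_iff_pairwise {l : List (ℕ × Bool)} :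
    IsOverpartition l ↔ (∀ p ∈ l, 1 ≤ p.1) ∧
      l.Pairwise fun x y => y.1 < x.1 ∨ (x.1 = y.1 ∧ x.2 = false) :=
  ⟨fun h => ⟨h.1, h.pairwise⟩, fun h => ⟨h.1, h.2.isChain⟩⟩

lemma exists_eq_append_partBlock {l : List (ℕ × Bool)} (v : ℕ)
    (hl : l.Pairwise fun x y => y.1 < x.1 ∨ (x.1 = y.1 ∧ x.2 = false))
    (hv : ∀ p ∈ l, v ≤ p.1) :
    ∃ l' f b, l = l' ++ partBlock v f b ∧ ∀ p ∈ l', v + 1 ≤ p.1 := by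
  induction l with
  | nil => exact ⟨[], 0, false, by simp [partBlock]⟩
  | cons p l ih =>
    rw [List.pairwise_cons] at hl
    obtain ⟨l', f, b, rfl, h⟩ := ih hl.2 fun q hq => hv q (by simp [hq])
    rcases (hv p (by simp)).lt_or_eq with hp | hp
    · exact ⟨p :: l', f, b, by simp, List.forall_mem_cons.2 ⟨hp, h⟩⟩
    · have hl' : l' = [] := by
        rw [List.eq_nil_iff_forall_not_mem]
        intro q hq
        have := h q hq
        have := hl.1 q (by simp [hq])
        omega
      subst hl'
      obtain ⟨w, x⟩ := p
      obtain rfl : v = w := hp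
      cases x
      · exact ⟨[], f + 1, b, by simp [partBlock, List.replicate_succ], by simp⟩
      · refine ⟨[], 0, true, ?_, by simp⟩
        have : partBlock v f b = [] := by
          rw [List.eq_nil_iff_forall_not_mem]
          intro q hq
          have := fst_of_mem_partBlock hq
          have := hl.1 q (by simp [hq])
          grind
        simp [this]
        simp [partBlock]

lemma filter_fst_append_partBlock {l : List (ℕ × Bool)} {v : ℕ} (hl : ∀ p ∈ l, v + 1 ≤ p.1)
    (f : ℕ) (b : Bool) :
    ((l ++ partBlock v f b).filter fun p => p.1 == v).length = f + b.toNat := by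
  rw [List.filter_append, List.filter_eq_nil_iff.2, List.filter_eq_self.2, List.nil_append,
    length_partBlock]
  · intro p hp
    simp [fst_of_mem_partBlock hp]
  · intro p hp
    have := hl p hp
    simp; omega

lemma isOverpartition_append_partBlock {l : List (ℕ × Bool)} {v : ℕ} (hv : 1 ≤ v)
    (hl : ∀ p ∈ l, v + 1 ≤ p.1) (f : ℕ) (b : Bool) :
    IsOverpartition (l ++ partBlock v f b) ↔ IsOverpartition l := by
  simp only [isOverpartition_iff_pairwise, List.pairwise_append, List.mem_append]
  constructor
  · rintro ⟨h₁, h₂, -⟩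
    exact ⟨fun p hp => h₁ p (.inl hp), h₂⟩
  · rintro ⟨h₁, h₂⟩
    refine ⟨?_, h₂, ?_, ?_⟩
    · rintro p (hp | hp)
      · exact h₁ p hp
      · rwa [fst_of_mem_partBlock hp]
    · cases b <;> simp [partBlock, List.pairwise_append, List.pairwise_replicate]
    · intro p hp q hq
      have := hl p hp
      have := fst_of_mem_partBlock hq
      omega

lemma gapCond_iff {k : ℕ} {l : List (ℕ × Bool)} :
    GapCond k l ↔ ∀ m p q, l[m]? = some p → l[m + (k - 1)]? = some q →
      q.1 + (if q.2 then 1 else 2) ≤ p.1 := by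
  constructor
  · intro h m p q hp hq
    have := h m (by grind)
    simpa [List.getD_eq_getElem?_getD, hp, hq] using this
  · intro h m hm
    have := h m l[m] l[m + (k - 1)] (by grind) (by grind)
    simpa [List.getD_eq_getElem?_getD, hm, show m < l.length by omega] using this

lemma getElem?_partBlock {v f : ℕ} {b : Bool} {j : ℕ} {p : ℕ × Bool}
    (h : (partBlock v f b)[j]? = some p) :
    p.1 = v ∧ (p.2 = false ∧ j < f ∨ p.2 = true ∧ j = f ∧ b = true) := by
  cases b <;> simp [partBlock] at h <;> grind

lemma GapCond.append_partBlock {k : ℕ} {l : List (ℕ × Bool)} {v : ℕ} {f : ℕ} {b : Bool}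
    (hk : 2 ≤ k) (hl : IsOverpartition l) (hv : ∀ p ∈ l, v + 1 ≤ p.1) (hf : f + b.toNat ≤ k - 1) :
    GapCond k (l ++ partBlock v f b) ↔
      GapCond k l ∧ (l.filter fun p => p.1 == v + 1).length ≤ k - 1 - f := by
  obtain ⟨l', f', b', rfl, hl'⟩ := exists_eq_append_partBlock (v + 1) hl.pairwise hv
  rw [filter_fst_append_partBlock hl']
  simp only [gapCond_iff]
  have hlen := length_partBlock v f b
  have hlen' := length_partBlock (v + 1) f' b'
  constructor
  · intro h
    refine ⟨fun m p q hp hq => h m p q (by grind) (by grind), ?_⟩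
    by_contra! hlt
    have hj : l'.length + (f' + b'.toNat) + f - 1 <
        (l' ++ partBlock (v + 1) f' b' ++ partBlock v f b).length := by
      simp only [List.length_append, hlen, hlen']; omega
    obtain ⟨m, hm⟩ : ∃ m, m + (k - 1) = l'.length + (f' + b'.toNat) + f - 1 :=
      ⟨l'.length + (f' + b'.toNat) + f - 1 - (k - 1), by omega⟩
    have hm' : l'.length ≤ m := by omega
    have key := h m _ _ (List.getElem?_eq_getElem (by omega))
      (by rw [hm]; exact List.getElem?_eq_getElem hj)
    set P := (l' ++ partBlock (v + 1) f' b' ++ partBlock v f b)[m]'(by omega) with hP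
    have hP1 : P.1 ≤ v + 1 := by
      simp only [List.append_assoc] at hP
      rw [List.getElem_append_right hm'] at hP
      have : P ∈ partBlock (v + 1) f' b' ++ partBlock v f b := by
        rw [hP]; exact List.getElem_mem _
      rcases List.mem_append.1 this with h' | h' <;> have := fst_of_mem_partBlock h' <;> omega
    set Q := (l' ++ partBlock (v + 1) f' b' ++ partBlock v f b)[l'.length + (f' + b'.toNat) + f - 1]
      with hQ
    rcases Nat.eq_zero_or_pos f with h0 | h0
    · have hQ' : Q ∈ partBlock (v + 1) f' b' := by
        rw [List.getElem_append_left (by simp only [List.length_append, hlen']; omega),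
          List.getElem_append_right (by omega)] at hQ
        rw [hQ]; exact List.getElem_mem _
      have := fst_of_mem_partBlock hQ'
      split_ifs at key <;> omega
    · have hQ' : (partBlock v f b)[f - 1]? = some Q := by
        rw [List.getElem_append_right (by simp only [List.length_append, hlen']; omega)] at hQ
        rw [hQ, List.getElem?_eq_some_iff]
        simp only [List.length_append, hlen']
        exact ⟨by omega, by congr 1; omega⟩
      obtain ⟨h1, h2⟩ := getElem?_partBlock hQ'
      have h3 : Q.2 = false := by
        rcases h2 with h2 | h2
        · exact h2.1
        · omega
      simp only [h3, Bool.false_eq_true, if_false] at key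
      omega
  · rintro ⟨h, hc⟩ m p q hp hq
    by_cases hj : m + (k - 1) < (l' ++ partBlock (v + 1) f' b').length
    · rw [List.getElem?_append_left hj] at hq
      rw [List.getElem?_append_left (by omega)] at hp
      exact h m p q hp hq
    · rw [List.getElem?_append_right (by omega)] at hq
      obtain ⟨h1, h2⟩ := getElem?_partBlock hq
      simp only [List.length_append, hlen'] at h2 hj
      rcases h2 with ⟨h2, h3⟩ | ⟨h2, h3, h4⟩
      · rw [List.append_assoc, List.getElem?_append_left (by omega)] at hp
        have := hl' p (List.mem_of_getElem? hp)
        simp [h1, h2]; omega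
      · simp only [h4, Bool.toNat_true] at hf
        rw [List.getElem?_append_left (by simp only [List.length_append, hlen']; omega)] at hp
        have := hv p (List.mem_of_getElem? hp)
        simp [h1, h2]; omega

/-- The overpartitions of `n` with parts at least `v`, at most `c` of which equal `v`, satisfying
the Gordon difference condition. -/
def gordonSet (k c v n : ℕ) : Set (List (ℕ × Bool)) :=
  {l | IsOverpartition l ∧ (∀ p ∈ l, v ≤ p.1) ∧ GapCond k l ∧
    (l.filter fun p => p.1 == v).length ≤ c ∧ opWeight l = n}

lemma append_partBlock_mem_gordonSet {k c v n f : ℕ} {b : Bool} {l : List (ℕ × Bool)} (hk : 2 ≤ k)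
    (hv : 1 ≤ v) (hc : f + b.toNat ≤ c) (hf : f + b.toNat ≤ k - 1)
    (hl : ∀ p ∈ l, v + 1 ≤ p.1) :
    l ++ partBlock v f b ∈ gordonSet k c v (n + v * (f + b.toNat)) ↔
      l ∈ gordonSet k (k - 1 - f) (v + 1) n := by
  simp only [gordonSet, Set.mem_ofPred_eq, isOverpartition_append_partBlock hv hl,
    filter_fst_append_partBlock hl, opWeight_append, opWeight_partBlock]
  constructor
  · rintro ⟨h₁, -, h₃, -, h₅⟩
    rw [GapCond.append_partBlock hk h₁ hl hf] at h₃
    exact ⟨h₁, hl, h₃.1, h₃.2, by omega⟩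
  · rintro ⟨h₁, -, h₃, h₄, h₅⟩
    refine ⟨h₁, ?_, (GapCond.append_partBlock hk h₁ hl hf).2 ⟨h₃, h₄⟩, hc, by omega⟩
    intro p hp
    rcases List.mem_append.1 hp with hp | hp
    · have := hl p hp
      omega
    · exact (fst_of_mem_partBlock hp).ge

lemma exists_of_mem_gordonSet {k c v n : ℕ} {l : List (ℕ × Bool)} (hk : 2 ≤ k) (hv : 1 ≤ v)
    (hc : c ≤ k - 1) (hl : l ∈ gordonSet k c v n) :
    ∃ l' f b n', n = n' + v * (f + b.toNat) ∧ f + b.toNat ≤ c ∧ l = l' ++ partBlock v f b ∧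
      l' ∈ gordonSet k (k - 1 - f) (v + 1) n' := by
  obtain ⟨l', f, b, rfl, h⟩ := exists_eq_append_partBlock v hl.1.pairwise hl.2.1
  have hfc : f + b.toNat ≤ c := by
    rw [← filter_fst_append_partBlock h f b]
    exact hl.2.2.2.1
  have hn : n = opWeight l' + v * (f + b.toNat) := by
    rw [← opWeight_partBlock, ← opWeight_append]
    exact hl.2.2.2.2.symm
  refine ⟨l', f, b, opWeight l', hn, hfc, rfl, ?_⟩
  rw [hn] at hl
  exact (append_partBlock_mem_gordonSet hk hv hfc (by omega) h).1 hl

lemma finite_setOf_opWeight_eq (n : ℕ) :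
    {l : List (ℕ × Bool) | (∀ p ∈ l, 1 ≤ p.1) ∧ opWeight l = n}.Finite := by
  induction n using Nat.strong_induction_on with
  | _ n ih =>
    have hfin : (⋃ w ∈ Finset.range n, ⋃ p ∈ Finset.range (n + 1) ×ˢ (Finset.univ : Finset Bool),
        List.cons p '' {l : List (ℕ × Bool) | (∀ p ∈ l, 1 ≤ p.1) ∧ opWeight l = w}).Finite :=
      Set.Finite.biUnion (Finset.finite_toSet _) fun w hw =>
        Set.Finite.biUnion (Finset.finite_toSet _) fun p _ =>
          (ih w (by simpa using hw)).image _
    refine (hfin.insert []).subset ?_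
    rintro (_ | ⟨p, l⟩) ⟨h₁, h₂⟩
    · simp
    · have hp := h₁ p (by simp)
      have hw : opWeight (p :: l) = p.1 + opWeight l := by simp [opWeight]
      right
      simp only [Set.mem_iUnion]
      exact ⟨opWeight l, by simp; omega, p, by simp; omega, l,
        ⟨fun q hq => h₁ q (by simp [hq]), rfl⟩, rfl⟩

lemma finite_gordonSet (k c v n : ℕ) : (gordonSet k c v n).Finite :=
  (finite_setOf_opWeight_eq n).subset fun _ hl => ⟨hl.1.1, hl.2.2.2.2⟩

lemma gordonSet_zero_eq {k v : ℕ} (hk : 2 ≤ k) (hv : 1 ≤ v) (n : ℕ) :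
    gordonSet k 0 v n = gordonSet k (k - 1) (v + 1) n := by
  ext l
  constructor
  · intro hl
    obtain ⟨l', f, b, n', rfl, hfb, rfl, hl'⟩ := exists_of_mem_gordonSet hk hv (by omega) hl
    obtain rfl : f = 0 := by omega
    obtain rfl : b = false := by
      cases b
      · rfl
      · simp at hfb
    simpa [partBlock] using hl'
  · intro hl
    have := (append_partBlock_mem_gordonSet (c := 0) (f := 0) (b := false) hk hv (by simp) (by simp)
      hl.2.1 (n := n)).2 hl
    simpa [partBlock] using this

lemma append_partBlock_image_subset {k c v n f : ℕ} {b : Bool} (hk : 2 ≤ k) (hv : 1 ≤ v)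
    (hc : f + b.toNat ≤ c) (hck : c ≤ k - 1) :
    (· ++ partBlock v f b) '' gordonSet k (k - 1 - f) (v + 1) n ⊆
      gordonSet k c v (n + v * (f + b.toNat)) := by
  rintro _ ⟨l, hl, rfl⟩
  exact (append_partBlock_mem_gordonSet hk hv hc (by omega) hl.2.1).2 hl

lemma gordonSet_succ_of_lt {k c v n : ℕ} (hk : 2 ≤ k) (hv : 1 ≤ v) (hc : c + 1 ≤ k - 1)
    (hn : n < v * (c + 1)) : gordonSet k (c + 1) v n = gordonSet k c v n := by
  ext l
  constructor
  · intro hl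
    obtain ⟨l', f, b, n', rfl, hfb, rfl, hl'⟩ := exists_of_mem_gordonSet hk hv hc hl
    have : f + b.toNat < c + 1 := by
      by_contra! h
      have := Nat.mul_le_mul_left v h
      omega
    exact append_partBlock_image_subset hk hv (by omega) (by omega) ⟨l', hl', rfl⟩
  · rintro ⟨h₁, h₂, h₃, h₄, h₅⟩
    exact ⟨h₁, h₂, h₃, by omega, h₅⟩

lemma gordonSet_succ_add {k c v : ℕ} (hk : 2 ≤ k) (hv : 1 ≤ v) (hc : c + 1 ≤ k - 1) (n : ℕ) :
    gordonSet k (c + 1) v (n + v * (c + 1)) = gordonSet k c v (n + v * (c + 1)) ∪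
      ((· ++ partBlock v (c + 1) false) '' gordonSet k (k - 1 - (c + 1)) (v + 1) n ∪
        (· ++ partBlock v c true) '' gordonSet k (k - 1 - c) (v + 1) n) := by
  ext l
  constructor
  · intro hl
    obtain ⟨l', f, b, n', hn, hfb, rfl, hl'⟩ := exists_of_mem_gordonSet hk hv hc hl
    rcases hfb.lt_or_eq with h | h
    · left
      rw [hn]
      exact append_partBlock_image_subset hk hv (by omega) (by omega) ⟨l', hl', rfl⟩
    · right
      obtain rfl : n = n' := by
        rw [h] at hn
        omega
      cases b
      · obtain rfl : f = c + 1 := by simpa using h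
        exact .inl ⟨l', hl', rfl⟩
      · obtain rfl : f = c := by simpa using h
        exact .inr ⟨l', hl', rfl⟩
  · rintro (⟨h₁, h₂, h₃, h₄, h₅⟩ | h | h)
    · exact ⟨h₁, h₂, h₃, by omega, h₅⟩
    · exact append_partBlock_image_subset (b := false) hk hv le_rfl hc h
    · exact append_partBlock_image_subset (b := true) hk hv le_rfl hc h

lemma ncard_gordonSet_succ_add {k c v : ℕ} (hk : 2 ≤ k) (hv : 1 ≤ v) (hc : c + 1 ≤ k - 1)
    (n : ℕ) :
    (gordonSet k (c + 1) v (n + v * (c + 1))).ncard = (gordonSet k c v (n + v * (c + 1))).ncard +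
      ((gordonSet k (k - 1 - (c + 1)) (v + 1) n).ncard +
        (gordonSet k (k - 1 - c) (v + 1) n).ncard) := by
  have hfin (c v n : ℕ) : Finite (gordonSet k c v n) := finite_gordonSet k c v n
  rw [gordonSet_succ_add hk hv hc, Set.ncard_union_eq, Set.ncard_union_eq,
    Set.ncard_image_of_injective _ (List.append_left_injective _),
    Set.ncard_image_of_injective _ (List.append_left_injective _)]
  · rw [Set.disjoint_left]
    rintro _ ⟨l₁, -, rfl⟩ ⟨l₂, -, h⟩
    have := congrArg (fun l => l.getLast?) h
    simp [partBlock, List.getLast?_append, List.getLast?_replicate] at this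
  · rw [Set.disjoint_left]
    rintro l hl (⟨l', hl', rfl⟩ | ⟨l', hl', rfl⟩)
    · have := hl.2.2.2.1
      rw [filter_fst_append_partBlock hl'.2.1] at this
      simp at this
    · have := hl.2.2.2.1
      rw [filter_fst_append_partBlock hl'.2.1] at this
      simp at this

/-- The generating function of `gordonSet`. -/
noncomputable def gordonSeries (k c v : ℕ) : ℚ⟦X⟧ :=
  PowerSeries.mk fun n => ((gordonSet k c v n).ncard : ℚ)

lemma gordonSeries_zero {k v : ℕ} (hk : 2 ≤ k) (hv : 1 ≤ v) :
    gordonSeries k 0 v = gordonSeries k (k - 1) (v + 1) := by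
  ext n
  simp [gordonSeries, gordonSet_zero_eq hk hv]

lemma gordonSeries_succ {k c v : ℕ} (hk : 2 ≤ k) (hv : 1 ≤ v) (hc : c + 1 ≤ k - 1) :
    gordonSeries k (c + 1) v = gordonSeries k c v + X ^ (v * (c + 1)) *
      (gordonSeries k (k - 1 - (c + 1)) (v + 1) + gordonSeries k (k - 1 - c) (v + 1)) := by
  ext n
  rw [map_add, coeff_X_pow_mul']
  split_ifs with h
  · obtain ⟨n, rfl⟩ := Nat.exists_eq_add_of_le' h
    simp [gordonSeries, ncard_gordonSet_succ_add hk hv hc]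
  · simp [gordonSeries, gordonSet_succ_of_lt hk hv hc (not_le.1 h)]

lemma X_pow_dvd_gordonSeries_sub_one (k c v : ℕ) :
    (X : ℚ⟦X⟧) ^ v ∣ gordonSeries k c v - 1 := by
  rw [X_pow_dvd_iff]
  intro n hn
  have hset : gordonSet k c v n = if n = 0 then {[]} else ∅ := by
    ext l
    cases l with
    | nil => split_ifs with h <;> 
        simp [gordonSet, opWeight, isOverpartition_iff_pairwise, GapCond, @eq_comm _ 0 n, h]
    | cons p l =>
      have : p :: l ∉ gordonSet k c v n := by
        intro h
        have h₁ := h.2.1 p (by simp)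
        have h₂ : p.1 + opWeight l = n := by simpa [opWeight] using h.2.2.2.2
        omega
      split_ifs <;> simp [this]
  rw [map_sub, coeff_one, gordonSeries, coeff_mk, hset]
  split_ifs <;> simp

lemma isSuperpartition_iff_pairwise {l : List (ℕ × Bool)} :
    IsSuperpartition l ↔ (∀ p ∈ l, 1 ≤ p.1 ∨ p.2 = true) ∧
      l.Pairwise fun x y => y.1 < x.1 ∨ (x.1 = y.1 ∧ y.2 = false) := by
  have : IsTrans (ℕ × Bool) fun x y => y.1 < x.1 ∨ (x.1 = y.1 ∧ y.2 = false) :=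
    ⟨by intro a b c; grind⟩
  exact and_congr_right fun _ => List.isChain_iff_pairwise

/-- The superpartitions of `n` with parts at most `M` and non-overlined parts satisfying `A`. -/
def superSet (A : ℕ → Prop) (M n : ℕ) : Set (List (ℕ × Bool)) :=
  {l | IsSuperpartition l ∧ (∀ p ∈ l, p.1 ≤ M) ∧ (∀ p ∈ l, p.2 = false → A p.1) ∧ opWeight l = n}

/-- The elements of `superSet A M n` without an overlined part `M`. -/
def superSetPlain (A : ℕ → Prop) (M n : ℕ) : Set (List (ℕ × Bool)) :=
  {l | l ∈ superSet A M n ∧ (M, true) ∉ l}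

lemma opWeight_cons (p : ℕ × Bool) (l : List (ℕ × Bool)) :
    opWeight (p :: l) = p.1 + opWeight l := by
  simp [opWeight]

lemma mem_superSet_succ {A : ℕ → Prop} {M n : ℕ} {l : List (ℕ × Bool)} :
    l ∈ superSet A (M + 1) n ↔ l ∈ superSetPlain A (M + 1) n ∨
      ∃ l' n', l' ∈ superSetPlain A (M + 1) n' ∧ n' + (M + 1) = n ∧ (M + 1, true) :: l' = l := by
  simp only [superSetPlain, superSet, isSuperpartition_iff_pairwise, Set.mem_ofPred_eq]
  constructor
  · rintro ⟨⟨h₁, h₂⟩, h₃, h₄, rfl⟩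
    by_cases hM : (M + 1, true) ∈ l
    · right
      cases l with
      | nil => simp at hM
      | cons p l =>
        rw [List.pairwise_cons] at h₂
        refine ⟨l, opWeight l, ⟨⟨⟨by grind, h₂.2⟩, by grind, by grind, rfl⟩, ?_⟩, ?_, ?_⟩
        · grind
        · rw [opWeight_cons]
          grind
        · grind
    · exact .inl ⟨⟨⟨h₁, h₂⟩, h₃, h₄, rfl⟩, hM⟩
  · rintro (h | ⟨l, n, ⟨⟨⟨h₁, h₂⟩, h₃, h₄, rfl⟩, h₅⟩, rfl, rfl⟩)
    · exact h.1
    · rw [List.pairwise_cons, opWeight_cons]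
      refine ⟨⟨by grind, ?_, h₂⟩, by grind, by grind, by grind⟩
      rintro ⟨a, b⟩ hp
      have := h₃ _ hp
      cases b <;> grind

lemma mem_superSetPlain_succ {A : ℕ → Prop} {M n : ℕ} {l : List (ℕ × Bool)} (hA : A (M + 1)) :
    l ∈ superSetPlain A (M + 1) n ↔ l ∈ superSet A M n ∨
      ∃ l' n', l' ∈ superSetPlain A (M + 1) n' ∧ n' + (M + 1) = n ∧ (M + 1, false) :: l' = l := by
  simp only [superSetPlain, superSet, isSuperpartition_iff_pairwise, Set.mem_ofPred_eq]
  constructor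
  · rintro ⟨⟨⟨h₁, h₂⟩, h₃, h₄, rfl⟩, h₅⟩
    by_cases hM : (M + 1, false) ∈ l
    · right
      cases l with
      | nil => simp at hM
      | cons p l =>
        rw [List.pairwise_cons] at h₂
        have hp : p = (M + 1, false) := by
          obtain ⟨a, b⟩ := p
          have := h₃ _ List.mem_cons_self
          cases b <;> grind
        subst hp
        refine ⟨l, opWeight l, ⟨⟨⟨by grind, h₂.2⟩, by grind, by grind, rfl⟩, by grind⟩, ?_, rfl⟩
        rw [opWeight_cons, add_comm]
    · left
      refine ⟨⟨h₁, h₂⟩, ?_, h₄, rfl⟩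
      rintro ⟨a, b⟩ hp
      have := h₃ _ hp
      cases b <;> grind
  · rintro (⟨⟨h₁, h₂⟩, h₃, h₄, rfl⟩ | ⟨l, n, ⟨⟨⟨h₁, h₂⟩, h₃, h₄, rfl⟩, h₅⟩, rfl, rfl⟩)
    · exact ⟨⟨⟨h₁, h₂⟩, by grind, h₄, rfl⟩, by grind⟩
    · rw [List.pairwise_cons, opWeight_cons]
      refine ⟨⟨⟨by grind, ?_, h₂⟩, by grind, by grind, by grind⟩, by grind⟩
      rintro ⟨a, b⟩ hp
      have := h₃ _ hp
      cases b <;> grind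

lemma superSetPlain_succ_of_not {A : ℕ → Prop} {M n : ℕ} (hA : ¬ A (M + 1)) :
    superSetPlain A (M + 1) n = superSet A M n := by
  ext l
  simp only [superSetPlain, superSet, Set.mem_ofPred_eq]
  constructor
  · rintro ⟨⟨h₁, h₃, h₄, rfl⟩, h₅⟩
    refine ⟨h₁, ?_, h₄, rfl⟩
    rintro ⟨a, b⟩ hp
    have := h₃ _ hp
    cases b <;> grind
  · rintro ⟨h₁, h₃, h₄, rfl⟩
    exact ⟨⟨h₁, by grind, h₄, rfl⟩, by grind⟩

lemma superSet_zero {A : ℕ → Prop} (n : ℕ) :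
    superSet A 0 n = if n = 0 then {[], [(0, true)]} else ∅ := by
  ext l
  simp only [superSet, isSuperpartition_iff_pairwise, Set.mem_ofPred_eq]
  constructor
  · rintro ⟨⟨h₁, h₂⟩, h₃, h₄, rfl⟩
    match l with
    | [] => simp [opWeight]
    | [(a, b)] =>
      have := h₁ (a, b) (by simp)
      have := h₃ (a, b) (by simp)
      simp [opWeight]
      grind
    | p :: q :: l =>
      have := h₁ q (by simp)
      have := h₃ q (by simp)
      have := h₃ p (by simp)
      grind
  · intro h
    split_ifs at h with hn
    · rcases h with rfl | rfl <;> simp [opWeight, hn]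
    · simp at h

lemma finite_superSet (A : ℕ → Prop) (M n : ℕ) : (superSet A M n).Finite := by
  induction M generalizing n with
  | zero =>
    rw [superSet_zero]
    split_ifs <;> simp
  | succ M ih =>
    have key (n : ℕ) : (superSetPlain A (M + 1) n).Finite := by
      by_cases hA : A (M + 1)
      · induction n using Nat.strong_induction_on with
        | _ n ihn =>
          refine ((ih n).union (((Set.finite_lt_nat n).biUnion fun n' hn' =>
            (ihn n' hn').image (List.cons (M + 1, false))))).subset ?_
          intro l hl
          rcases (mem_superSetPlain_succ hA).1 hl with h | ⟨l', n', h₁, h₂, rfl⟩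
          · exact .inl h
          · right
            simp only [Set.mem_iUnion]
            exact ⟨n', by simp; omega, l', h₁, rfl⟩
      · rw [superSetPlain_succ_of_not hA]
        exact ih n
    refine ((key n).union ((Set.finite_le_nat n).biUnion fun n' _ =>
      (key n').image (List.cons (M + 1, true)))).subset ?_
    intro l hl
    rcases mem_superSet_succ.1 hl with h | ⟨l', n', h₁, h₂, rfl⟩
    · exact .inl h
    · right
      simp only [Set.mem_iUnion]
      exact ⟨n', by simp; omega, l', h₁, rfl⟩

/-- The power series with coefficients the cardinalities of a graded family of sets. -/
noncomputable def cardSeries {α : Type*} (S : ℕ → Set α) : ℚ⟦X⟧ :=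
  PowerSeries.mk fun n => ((S n).ncard : ℚ)

lemma cardSeries_eq_add {α : Type*} {S T U : ℕ → Set α} {g : α → α} {e : ℕ}
    (hg : g.Injective) (hfin : ∀ n, (S n).Finite)
    (h : ∀ n x, x ∈ S n ↔ x ∈ T n ∨ ∃ y n', y ∈ U n' ∧ n' + e = n ∧ g y = x)
    (hT : ∀ n y, g y ∉ T n) :
    cardSeries S = cardSeries T + X ^ e * cardSeries U := by
  ext n
  rw [map_add, coeff_X_pow_mul']
  simp only [cardSeries, coeff_mk]
  split_ifs with hn
  · obtain ⟨n, rfl⟩ := Nat.exists_eq_add_of_le' hn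
    have hS : S (n + e) = T (n + e) ∪ g '' U n := by
      ext x
      rw [h]
      constructor
      · rintro (hx | ⟨y, n', hy, hn', rfl⟩)
        · exact .inl hx
        · obtain rfl : n' = n := by omega
          exact .inr ⟨y, hy, rfl⟩
      · rintro (hx | ⟨y, hy, rfl⟩)
        · exact .inl hx
        · exact .inr ⟨y, n, hy, rfl, rfl⟩
    have hfin' := hS ▸ hfin (n + e)
    rw [hS, Set.ncard_union_eq ?_ (hfin'.subset Set.subset_union_left)
      (hfin'.subset Set.subset_union_right), Set.ncard_image_of_injective _ hg, Nat.add_sub_cancel,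
      Nat.cast_add]
    rw [Set.disjoint_left]
    rintro _ hx ⟨y, -, rfl⟩
    exact hT _ _ hx
  · have hS : S n = T n := by
      ext x
      rw [h]
      refine or_iff_left ?_
      rintro ⟨y, n', -, hn', -⟩
      omega
    rw [hS, add_zero]

lemma cardSeries_superSet_zero (A : ℕ → Prop) : cardSeries (superSet A 0) = 2 := by
  ext n
  rw [cardSeries, coeff_mk, superSet_zero, show (2 : ℚ⟦X⟧) = C 2 from rfl, coeff_C]
  split_ifs
  · rw [Set.ncard_pair (by simp)]
    norm_num
  · simp

lemma cardSeries_superSet_succ (A : ℕ → Prop) (M : ℕ) [Decidable (A (M + 1))] :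
    (if A (M + 1) then 1 - X ^ (M + 1) else 1) * cardSeries (superSet A (M + 1)) =
      (1 + X ^ (M + 1)) * cardSeries (superSet A M) := by
  have h₁ : cardSeries (superSet A (M + 1)) = cardSeries (superSetPlain A (M + 1)) +
      X ^ (M + 1) * cardSeries (superSetPlain A (M + 1)) :=
    cardSeries_eq_add (List.cons_injective (a := (M + 1, true))) (finite_superSet A (M + 1))
      (fun n l => mem_superSet_succ) fun n l h => h.2 (by simp)
  rw [h₁]
  split_ifs with hA
  · have h₂ : cardSeries (superSetPlain A (M + 1)) = cardSeries (superSet A M) +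
        X ^ (M + 1) * cardSeries (superSetPlain A (M + 1)) :=
      cardSeries_eq_add (List.cons_injective (a := (M + 1, false)))
        (fun n => (finite_superSet A (M + 1) n).subset fun _ h => h.1)
        (fun n l => mem_superSetPlain_succ hA)
        fun n l h => by simpa using h.2.1 (M + 1, false) (by simp)
    linear_combination (1 + X ^ (M + 1)) * h₂
  · have h₂ : superSetPlain A (M + 1) = superSet A M :=
      funext fun n => superSetPlain_succ_of_not hA
    rw [h₂]
    ring

lemma prod_mul_cardSeries_superSet (A : ℕ → Prop) [DecidablePred A] (M : ℕ) :
    (∏ u ∈ Finset.range M, if A (u + 1) then 1 - X ^ (u + 1) else 1) *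
        cardSeries (superSet A M) =
      2 * ∏ u ∈ Finset.range M, (1 + X ^ (u + 1)) := by
  induction M with
  | zero => simp [cardSeries_superSet_zero]
  | succ M ih =>
    rw [Finset.prod_range_succ, Finset.prod_range_succ, mul_assoc, cardSeries_superSet_succ]
    linear_combination (1 + X ^ (M + 1)) * ih

section Theta

lemma one_add_X_pow_mul_inv (j : ℕ) : (1 + X ^ j : ℚ⟦X⟧) * (1 + X ^ j)⁻¹ = 1 := by
  refine PowerSeries.mul_inv_cancel _ ?_
  rcases Nat.eq_zero_or_pos j with rfl | hj
  · simp
  · simp [hj.ne']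

/-- The common factor of the terms of the bilateral theta-like sums below. -/
noncomputable def thetaFactor (m n : ℕ) : ℚ⟦X⟧ :=
  2 * (-1) ^ n * ∏ j ∈ Finset.range m, ((1 - X ^ (n + 1 + j)) * (1 + X ^ (n + 1 + j))⁻¹)

/-- The terms of nonnegative index, with `d` standing for `k - c`. -/
noncomputable def thetaPos (k d m n : ℕ) : ℚ⟦X⟧ :=
  X ^ (n * (k * (n + m) + d)) * thetaFactor m n * (1 + X ^ n)⁻¹

/-- The terms of negative index, up to sign. -/
noncomputable def thetaNeg (k c m n : ℕ) : ℚ⟦X⟧ :=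
  X ^ ((n + m + 1) * (k * n + c + 1)) * thetaFactor m n * (1 + X ^ (n + m + 1))⁻¹

lemma thetaFactor_succ (m n : ℕ) : thetaFactor (m + 1) n =
    thetaFactor m n * ((1 - X ^ (n + m + 1)) * (1 + X ^ (n + m + 1))⁻¹) := by
  rw [thetaFactor, thetaFactor, Finset.prod_range_succ, show n + 1 + m = n + m + 1 by ring]
  ring

lemma thetaFactor_succ_eq_neg (m n : ℕ) : thetaFactor (m + 1) n =
    -thetaFactor m (n + 1) * ((1 - X ^ (n + 1)) * (1 + X ^ (n + 1))⁻¹) := by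
  have h (j : ℕ) : n + 1 + (j + 1) = n + 1 + 1 + j := by ring
  rw [thetaFactor, thetaFactor, Finset.prod_range_succ',
    Finset.prod_congr rfl fun j _ => by rw [h j], add_zero]
  ring

lemma thetaPos_sub_thetaNeg_zero (k m : ℕ) :
    thetaPos k k m 0 - thetaNeg k 0 m 0 = thetaPos k 1 (m + 1) 0 := by
  have h₁ := one_add_X_pow_mul_inv 0
  have h₂ := one_add_X_pow_mul_inv (m + 1)
  simp only [thetaPos, thetaNeg, thetaFactor_succ, zero_mul, zero_add, pow_zero, mul_zero, mul_one,
    one_mul] at *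
  set s := (1 + 1 : ℚ⟦X⟧)⁻¹
  set r := (1 + X ^ (m + 1) : ℚ⟦X⟧)⁻¹
  linear_combination (-thetaFactor m 0 * s) * h₂ + (thetaFactor m 0 * X ^ (m + 1) * r) * h₁

lemma thetaPos_sub_thetaNeg_succ (k m n : ℕ) :
    thetaPos (k + 1) (k + 1) m (n + 1) - thetaNeg (k + 1) 0 m (n + 1) =
      thetaPos (k + 1) 1 (m + 1) (n + 1) - thetaNeg (k + 1) k (m + 1) n := by
  have h₁ := one_add_X_pow_mul_inv (n + 1)
  have h₂ := one_add_X_pow_mul_inv (n + 1 + m + 1)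
  simp only [thetaPos, thetaNeg, thetaFactor_succ m (n + 1), thetaFactor_succ_eq_neg m n]
  rw [show n + (m + 1) + 1 = n + 1 + m + 1 by ring]
  set s := (1 + X ^ (n + 1) : ℚ⟦X⟧)⁻¹
  set r := (1 + X ^ (n + 1 + m + 1) : ℚ⟦X⟧)⁻¹
  set x : ℚ⟦X⟧ := X ^ (n + 1) with hx
  set y : ℚ⟦X⟧ := X ^ (n + 1 + m + 1) with hy
  have e₁ : (X : ℚ⟦X⟧) ^ ((n + 1) * ((k + 1) * (n + 1 + m) + (k + 1))) = y ^ ((k + 1) * (n + 1)) := by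
    rw [hy, ← pow_mul]; congr 1; ring
  have e₂ : (X : ℚ⟦X⟧) ^ ((n + 1 + m + 1) * ((k + 1) * (n + 1) + 0 + 1)) =
      y ^ ((k + 1) * (n + 1)) * y := by
    rw [hy, ← pow_succ, ← pow_mul]
  have e₃ : (X : ℚ⟦X⟧) ^ ((n + 1) * ((k + 1) * (n + 1 + (m + 1)) + 1)) =
      y ^ ((k + 1) * (n + 1)) * x := by
    rw [hy, hx, ← pow_mul, ← pow_add]; congr 1; ring
  have e₄ : (X : ℚ⟦X⟧) ^ ((n + 1 + m + 1) * ((k + 1) * n + k + 1)) = y ^ ((k + 1) * (n + 1)) := by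
    rw [hy, ← pow_mul]; congr 1
  rw [e₁, e₂, e₃, e₄]
  set t := thetaFactor m (n + 1)
  set w := y ^ ((k + 1) * (n + 1))
  linear_combination (-w * t * s) * h₂ + (w * t * y * r) * h₁

lemma thetaPos_zero_right (k d m : ℕ) : thetaPos k d m 0 = thetaPos k (d + 1) m 0 := by
  simp [thetaPos]

lemma thetaPos_succ_sub (c d m n : ℕ) :
    thetaPos (c + d + 2) (d + 1) m (n + 1) - thetaPos (c + d + 2) (d + 2) m (n + 1) =
      -X ^ ((m + 1) * (c + 1)) * (thetaNeg (c + d + 2) d (m + 1) n +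
        thetaNeg (c + d + 2) (d + 1) (m + 1) n) := by
  have h₂ := one_add_X_pow_mul_inv (n + 1 + m + 1)
  simp only [thetaPos, thetaNeg, thetaFactor_succ_eq_neg m n]
  rw [show n + (m + 1) + 1 = n + 1 + m + 1 by ring]
  set s := (1 + X ^ (n + 1) : ℚ⟦X⟧)⁻¹
  set r := (1 + X ^ (n + 1 + m + 1) : ℚ⟦X⟧)⁻¹
  set t := thetaFactor m (n + 1)
  set w : ℚ⟦X⟧ := X ^ ((n + 1) * ((c + d + 2) * (n + 1 + m) + (d + 1))) with hw
  have e₁ : (X : ℚ⟦X⟧) ^ ((n + 1) * ((c + d + 2) * (n + 1 + m) + (d + 2))) = w * X ^ (n + 1) := by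
    rw [hw, ← pow_add]; congr 1
  have e₂ : (X : ℚ⟦X⟧) ^ ((m + 1) * (c + 1)) *
      X ^ ((n + 1 + m + 1) * ((c + d + 2) * n + d + 1)) = w := by
    rw [hw, ← pow_add]; congr 1; ring
  have e₃ : (X : ℚ⟦X⟧) ^ ((n + 1 + m + 1) * ((c + d + 2) * n + (d + 1) + 1)) =
      X ^ ((n + 1 + m + 1) * ((c + d + 2) * n + d + 1)) * X ^ (n + 1 + m + 1) := by
    rw [← pow_add]; congr 1
  rw [e₁, e₃]
  linear_combination (-w * t * s * (1 - X ^ (n + 1))) * h₂ -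
    (t * s * (1 - X ^ (n + 1)) * (1 + X ^ (n + 1 + m + 1)) * r) * e₂

lemma thetaNeg_sub_thetaNeg_succ (c d m n : ℕ) :
    thetaNeg (c + d + 2) c m n - thetaNeg (c + d + 2) (c + 1) m n =
      X ^ ((m + 1) * (c + 1)) * (thetaPos (c + d + 2) (c + 2) (m + 1) n +
        thetaPos (c + d + 2) (c + 1) (m + 1) n) := by
  have h₁ := one_add_X_pow_mul_inv n
  simp only [thetaPos, thetaNeg, thetaFactor_succ m n]
  set s := (1 + X ^ n : ℚ⟦X⟧)⁻¹
  set r := (1 + X ^ (n + m + 1) : ℚ⟦X⟧)⁻¹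
  set t := thetaFactor m n
  set w : ℚ⟦X⟧ := X ^ ((n + m + 1) * ((c + d + 2) * n + c + 1)) with hw
  have e₁ : (X : ℚ⟦X⟧) ^ ((n + m + 1) * ((c + d + 2) * n + (c + 1) + 1)) =
      w * X ^ (n + m + 1) := by
    rw [hw, ← pow_add]; congr 1
  have e₂ : (X : ℚ⟦X⟧) ^ ((m + 1) * (c + 1)) *
      X ^ (n * ((c + d + 2) * (n + (m + 1)) + (c + 1))) = w := by
    rw [hw, ← pow_add]; congr 1; ring
  have e₃ : (X : ℚ⟦X⟧) ^ (n * ((c + d + 2) * (n + (m + 1)) + (c + 2))) =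
      X ^ (n * ((c + d + 2) * (n + (m + 1)) + (c + 1))) * X ^ n := by
    rw [← pow_add]; congr 1
  rw [e₁, e₃]
  linear_combination (-w * t * r * (1 - X ^ (n + m + 1))) * h₁ -
    (t * r * (1 - X ^ (n + m + 1)) * (1 + X ^ n) * s) * e₂

/-- Partial sums of the theta-like series. -/
noncomputable def thetaSum (N k c m : ℕ) : ℚ⟦X⟧ :=
  ∑ n ∈ Finset.range (N + 1), (thetaPos k (k - c) m n - thetaNeg k c m n)

lemma thetaSum_zero (N k m : ℕ) :
    thetaSum N (k + 1) 0 m = thetaSum N (k + 1) k (m + 1) + thetaNeg (k + 1) k (m + 1) N := by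
  simp only [thetaSum, Nat.sub_zero, Nat.add_sub_cancel_left]
  rw [Finset.sum_range_succ', thetaPos_sub_thetaNeg_zero,
    Finset.sum_congr rfl fun n _ => thetaPos_sub_thetaNeg_succ k m n, Finset.sum_sub_distrib,
    Finset.sum_sub_distrib, Finset.sum_range_succ' (fun n => thetaPos _ _ _ n),
    Finset.sum_range_succ (fun n => thetaNeg _ _ _ n)]
  ring

lemma thetaSum_succ (N c d m : ℕ) :
    thetaSum N (c + d + 2) (c + 1) m = thetaSum N (c + d + 2) c m +
      X ^ ((m + 1) * (c + 1)) * (thetaSum N (c + d + 2) d (m + 1) +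
        thetaSum N (c + d + 2) (d + 1) (m + 1) +
        (thetaNeg (c + d + 2) d (m + 1) N + thetaNeg (c + d + 2) (d + 1) (m + 1) N)) := by
  simp only [thetaSum, show c + d + 2 - (c + 1) = d + 1 by omega,
    show c + d + 2 - c = d + 2 by omega, show c + d + 2 - d = c + 2 by omega,
    show c + d + 2 - (d + 1) = c + 1 by omega, Finset.sum_sub_distrib]
  have hp : ∑ n ∈ Finset.range (N + 1), thetaPos (c + d + 2) (d + 1) m n -
      ∑ n ∈ Finset.range (N + 1), thetaPos (c + d + 2) (d + 2) m n =
      -X ^ ((m + 1) * (c + 1)) * (∑ n ∈ Finset.range N, thetaNeg (c + d + 2) d (m + 1) n +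
        ∑ n ∈ Finset.range N, thetaNeg (c + d + 2) (d + 1) (m + 1) n) := by
    rw [Finset.sum_range_succ', Finset.sum_range_succ' (fun n => thetaPos _ (d + 2) _ n),
      thetaPos_zero_right _ (d + 1), add_sub_add_right_eq_sub, ← Finset.sum_sub_distrib,
      Finset.sum_congr rfl fun n _ => thetaPos_succ_sub c d m n, ← Finset.mul_sum,
      Finset.sum_add_distrib]
  have hn : ∑ n ∈ Finset.range (N + 1), thetaNeg (c + d + 2) c m n -
      ∑ n ∈ Finset.range (N + 1), thetaNeg (c + d + 2) (c + 1) m n =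
      X ^ ((m + 1) * (c + 1)) *
        (∑ n ∈ Finset.range (N + 1), thetaPos (c + d + 2) (c + 2) (m + 1) n +
          ∑ n ∈ Finset.range (N + 1), thetaPos (c + d + 2) (c + 1) (m + 1) n) := by
    rw [← Finset.sum_sub_distrib,
      Finset.sum_congr rfl fun n _ => thetaNeg_sub_thetaNeg_succ c d m n, ← Finset.mul_sum,
      Finset.sum_add_distrib]
  rw [Finset.sum_range_succ (fun n => thetaNeg _ d (m + 1) n),
    Finset.sum_range_succ (fun n => thetaNeg _ (d + 1) (m + 1) n)]
  linear_combination hp + hn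

lemma X_pow_dvd_thetaNeg {W k c m n : ℕ} (h : W ≤ (n + m + 1) * (k * n + c + 1)) :
    X ^ W ∣ thetaNeg k c m n :=
  ((pow_dvd_pow _ h).mul_right _).mul_right _

lemma X_pow_dvd_thetaPos {W k d m n : ℕ} (h : W ≤ n * (k * (n + m) + d)) :
    X ^ W ∣ thetaPos k d m n :=
  ((pow_dvd_pow _ h).mul_right _).mul_right _

lemma prod_mul_thetaPos_zero (k d m : ℕ) :
    (∏ u ∈ Finset.range m, (1 + X ^ (u + 1))) * thetaPos k d m 0 =
      ∏ u ∈ Finset.range m, (1 - X ^ (u + 1)) := by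
  have h₀ := one_add_X_pow_mul_inv 0
  have h₁ : (∏ u ∈ Finset.range m, (1 + X ^ (u + 1) : ℚ⟦X⟧)) *
      ∏ u ∈ Finset.range m, (1 + X ^ (u + 1))⁻¹ = 1 := by
    rw [← Finset.prod_mul_distrib]
    exact Finset.prod_eq_one fun u _ => one_add_X_pow_mul_inv _
  simp only [thetaPos, thetaFactor, zero_mul, pow_zero, one_mul, mul_one, zero_add,
    Finset.prod_mul_distrib, add_comm 1] at *
  linear_combination (∏ u ∈ Finset.range m, (1 - X ^ (u + 1) : ℚ⟦X⟧)) * h₀ +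
    (∏ u ∈ Finset.range m, (1 - X ^ (u + 1) : ℚ⟦X⟧)) * 2 * (1 + 1)⁻¹ * h₁

lemma X_pow_dvd_prod_sub_thetaSum (W N k c : ℕ) (hk : 1 ≤ k) :
    X ^ W ∣ ∏ u ∈ Finset.range W, (1 - X ^ (u + 1)) -
      (∏ u ∈ Finset.range W, (1 + X ^ (u + 1))) * thetaSum N k c W := by
  have h : ∏ u ∈ Finset.range W, (1 - X ^ (u + 1)) -
      (∏ u ∈ Finset.range W, (1 + X ^ (u + 1))) * thetaSum N k c W =
      (∏ u ∈ Finset.range W, (1 + X ^ (u + 1))) *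
        (∑ n ∈ Finset.range (N + 1), thetaNeg k c W n -
          ∑ n ∈ Finset.range N, thetaPos k (k - c) W (n + 1)) := by
    rw [thetaSum, Finset.sum_sub_distrib, Finset.sum_range_succ' (fun n => thetaPos _ _ _ n),
      ← prod_mul_thetaPos_zero k (k - c) W]
    ring
  rw [h]
  refine (dvd_sub (Finset.dvd_sum fun n _ => X_pow_dvd_thetaNeg ?_)
    (Finset.dvd_sum fun n _ => X_pow_dvd_thetaPos ?_)).mul_left _
  · nlinarith [Nat.zero_le ((n + W + 1) * (k * n + c))]
  · nlinarith [Nat.zero_le (n * (k * (n + 1 + W) + (k - c))), Nat.mul_le_mul_right W hk,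
      Nat.zero_le (k * (n + 1))]

/-- The difference between the generating function and its theta expansion, cleared of
denominators and truncated. -/
noncomputable def gordonDefect (W N k c m : ℕ) : ℚ⟦X⟧ :=
  (∏ u ∈ Finset.range W, (1 - X ^ (u + 1))) * gordonSeries k c (m + 1) -
    (∏ u ∈ Finset.range W, (1 + X ^ (u + 1))) * thetaSum N k c m

lemma X_pow_dvd_gordonDefect_self (W N k c : ℕ) (hk : 1 ≤ k) :
    X ^ W ∣ gordonDefect W N k c W := by
  have h₁ : X ^ W ∣ gordonSeries k c (W + 1) - 1 :=
    (pow_dvd_pow _ W.le_succ).trans (X_pow_dvd_gordonSeries_sub_one k c (W + 1))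
  have h := (h₁.mul_left (∏ u ∈ Finset.range W, (1 - X ^ (u + 1)))).add
    (X_pow_dvd_prod_sub_thetaSum W N k c hk)
  rw [gordonDefect]
  convert h using 1
  ring

lemma X_pow_dvd_gordonDefect_of_succ {W N k m : ℕ} (hk : 2 ≤ k) (hW : W ≤ (N + 1) * (k * N + 1))
    (h : ∀ c ≤ k - 1, X ^ W ∣ gordonDefect W N k c (m + 1)) (c : ℕ) (hc : c ≤ k - 1) :
    X ^ W ∣ gordonDefect W N k c m := by
  have hneg (c : ℕ) : X ^ W ∣ thetaNeg k c (m + 1) N :=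
    X_pow_dvd_thetaNeg (hW.trans (Nat.mul_le_mul (by omega) (by omega)))
  induction c with
  | zero =>
    obtain ⟨k, rfl⟩ : ∃ j, k = j + 1 := ⟨k - 1, by omega⟩
    have h' := (h k (by omega)).sub
      ((hneg k).mul_left (∏ u ∈ Finset.range W, (1 + X ^ (u + 1))))
    convert h' using 1
    rw [gordonDefect, gordonDefect, thetaSum_zero, gordonSeries_zero hk (by omega),
      Nat.add_sub_cancel]
    ring
  | succ c ih =>
    obtain ⟨d, rfl⟩ : ∃ d, k = c + d + 2 := ⟨k - c - 2, by omega⟩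
    have h' := (ih (by omega)).add
      ((((h d (by omega)).add (h (d + 1) (by omega))).sub
        (((hneg d).add (hneg (d + 1))).mul_left
          (∏ u ∈ Finset.range W, (1 + X ^ (u + 1))))).mul_left (X ^ ((m + 1) * (c + 1))))
    convert h' using 1
    simp only [gordonDefect]
    rw [thetaSum_succ, gordonSeries_succ hk (by omega) hc,
      show c + d + 2 - 1 - (c + 1) = d by omega, show c + d + 2 - 1 - c = d + 1 by omega]
    ring

lemma X_pow_dvd_gordonDefect {W N k : ℕ} (hk : 2 ≤ k) (hW : W ≤ (N + 1) * (k * N + 1))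
    {m : ℕ} (hm : m ≤ W) : ∀ c ≤ k - 1, X ^ W ∣ gordonDefect W N k c m := by
  induction hm using Nat.decreasingInduction with
  | self => exact fun c _ => X_pow_dvd_gordonDefect_self W N k c (by omega)
  | of_succ m _ ih => exact X_pow_dvd_gordonDefect_of_succ hk hW ih

lemma thetaSum_add_thetaSum_succ (N c d : ℕ) :
    thetaSum N (c + 1 + d) c 0 + thetaSum N (c + 1 + d) (c + 1) 0 =
      2 * ∑ n ∈ Finset.range (N + 1), (-1) ^ n *
        (X ^ (n * ((c + 1 + d) * n + d)) - X ^ ((n + 1) * ((c + 1 + d) * n + (c + 1)))) := by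
  rw [thetaSum, thetaSum, ← Finset.sum_add_distrib, Finset.mul_sum]
  refine Finset.sum_congr rfl fun n _ => ?_
  rw [show c + 1 + d - c = d + 1 by omega, show c + 1 + d - (c + 1) = d by omega]
  simp only [thetaPos, thetaNeg, thetaFactor, Finset.range_zero, Finset.prod_empty, mul_one,
    add_zero]
  have h₁ := one_add_X_pow_mul_inv n
  have h₂ := one_add_X_pow_mul_inv (n + 1)
  have e₁ : (X : ℚ⟦X⟧) ^ (n * ((c + 1 + d) * n + (d + 1))) =
      X ^ (n * ((c + 1 + d) * n + d)) * X ^ n := by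
    rw [← pow_add]; congr 1
  have e₂ : (X : ℚ⟦X⟧) ^ ((n + 1) * ((c + 1 + d) * n + (c + 1) + 1)) =
      X ^ ((n + 1) * ((c + 1 + d) * n + (c + 1))) * X ^ (n + 1) := by
    rw [← pow_add]; congr 1
  rw [e₁, e₂]
  simp only [add_assoc] at *
  linear_combination (2 * (-1) ^ n * X ^ (n * ((c + (1 + d)) * n + d))) * h₁ -
    (2 * (-1) ^ n * X ^ ((n + 1) * ((c + (1 + d)) * n + (c + 1)))) * h₂

end Theta

section QBinomial

variable {R : Type*} [CommRing R]

/-- The Gaussian binomial coefficients. -/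
def qBinom (Q : R) : ℕ → ℕ → R
  | _, 0 => 1
  | 0, _ + 1 => 0
  | M + 1, j + 1 => qBinom Q M j + Q ^ (j + 1) * qBinom Q M (j + 1)

/-- The `q`-Pochhammer symbol `(Q; Q)_M`. -/
def qFactor (Q : R) (M : ℕ) : R := ∏ j ∈ Finset.range M, (1 - Q ^ (j + 1))

lemma qFactor_succ (Q : R) (M : ℕ) : qFactor Q (M + 1) = qFactor Q M * (1 - Q ^ (M + 1)) :=
  Finset.prod_range_succ _ _

lemma qBinom_zero_right (Q : R) (M : ℕ) : qBinom Q M 0 = 1 := by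
  cases M <;> rfl

lemma qBinom_succ_succ (Q : R) (M j : ℕ) :
    qBinom Q (M + 1) (j + 1) = qBinom Q M j + Q ^ (j + 1) * qBinom Q M (j + 1) := rfl

lemma qBinom_eq_zero_of_lt (Q : R) {M j : ℕ} (h : M < j) : qBinom Q M j = 0 := by
  induction M generalizing j with
  | zero =>
    obtain ⟨j, rfl⟩ : ∃ i, j = i + 1 := ⟨j - 1, by omega⟩
    rfl
  | succ M ih =>
    obtain ⟨j, rfl⟩ : ∃ i, j = i + 1 := ⟨j - 1, by omega⟩
    rw [qBinom_succ_succ, ih (by omega), ih (by omega), mul_zero, add_zero]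

lemma qBinom_self (Q : R) (M : ℕ) : qBinom Q M M = 1 := by
  induction M with
  | zero => rfl
  | succ M ih => rw [qBinom_succ_succ, ih, qBinom_eq_zero_of_lt Q M.lt_succ_self, mul_zero, add_zero]

lemma qFactor_mul_qBinom (Q : R) (j s : ℕ) :
    qFactor Q j * qFactor Q s * qBinom Q (j + s) j = qFactor Q (j + s) := by
  induction j generalizing s with
  | zero => simp [qFactor, qBinom_zero_right]
  | succ j ih =>
    induction s with
    | zero => simp [qBinom_self, qFactor]
    | succ s ih' =>
      have h₁ := ih (s + 1)
      rw [show j + 1 + (s + 1) = j + (s + 1) + 1 by ring, qBinom_succ_succ, qFactor_succ Q j,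
        qFactor_succ Q (j + (s + 1))]
      rw [show j + 1 + s = j + (s + 1) by ring, qFactor_succ Q j] at ih'
      have h₂ := qFactor_succ Q s
      have h₃ : Q ^ (j + (s + 1) + 1) = Q ^ (j + 1) * Q ^ (s + 1) := by ring
      rw [h₃]
      linear_combination (1 - Q ^ (j + 1)) * h₁ + Q ^ (j + 1) * (1 - Q ^ (s + 1)) * ih' +
        Q ^ (j + 1) * (qFactor Q j * (1 - Q ^ (j + 1)) * qBinom Q (j + (s + 1)) (j + 1)) * h₂

lemma prod_sub_mul_pow (Q y z : R) (M : ℕ) :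
    ∏ j ∈ Finset.range M, (y - z * Q ^ j) = ∑ j ∈ Finset.range (M + 1),
      (-1) ^ j * Q ^ (j.choose 2) * qBinom Q M j * z ^ j * y ^ (M - j) := by
  induction M generalizing z with
  | zero => simp [qBinom]
  | succ M ih =>
    have hprod : ∏ j ∈ Finset.range (M + 1), (y - z * Q ^ j) =
        (∏ j ∈ Finset.range M, (y - z * Q * Q ^ j)) * (y - z) := by
      rw [Finset.prod_range_succ']
      simp [pow_succ', mul_assoc]
    have hchoose (j : ℕ) : (j + 1).choose 2 = j.choose 2 + j := by
      rw [Nat.choose_succ_succ' j 1, Nat.choose_one_right, add_comm]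
    rw [hprod, ih, mul_sub, Finset.sum_mul, Finset.sum_mul, Finset.sum_range_succ' _ (M + 1),
      Finset.sum_range_succ' _ M, add_sub_right_comm]
    congr 1
    · have hlast : ∑ j ∈ Finset.range (M + 1), (-1) ^ (j + 1) * Q ^ ((j + 1).choose 2) *
          qBinom Q M (j + 1) * (z * Q) ^ (j + 1) * y ^ (M - (j + 1)) * y =
          ∑ j ∈ Finset.range M, (-1) ^ (j + 1) * Q ^ ((j + 1).choose 2) *
          qBinom Q M (j + 1) * (z * Q) ^ (j + 1) * y ^ (M - (j + 1)) * y := by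
        rw [Finset.sum_range_succ, qBinom_eq_zero_of_lt Q M.lt_succ_self]
        ring
      rw [← hlast, ← Finset.sum_sub_distrib]
      refine Finset.sum_congr rfl fun j hj => ?_
      rw [qBinom_succ_succ, Nat.add_sub_add_right]
      rcases (Nat.lt_succ_iff.1 (Finset.mem_range.1 hj)).lt_or_eq with h | rfl
      · rw [show M - j = M - (j + 1) + 1 by omega, hchoose]
        ring
      · rw [qBinom_eq_zero_of_lt Q j.lt_succ_self, hchoose]
        ring
    · simp [qBinom_zero_right]
      ring

lemma pow_dvd_qFactor_sub (Q : R) {a b : ℕ} (h : a ≤ b) :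
    Q ^ (a + 1) ∣ qFactor Q b - qFactor Q a := by
  induction b, h using Nat.le_induction with
  | base => simp
  | succ b hb ih =>
    have : qFactor Q (b + 1) - qFactor Q a =
        (qFactor Q b - qFactor Q a) - Q ^ (b + 1) * qFactor Q b := by
      rw [qFactor_succ]
      ring
    rw [this]
    exact dvd_sub ih ((pow_dvd_pow _ (by omega)).mul_right _)

end QBinomial

section TripleProduct

lemma isUnit_qFactor {e : ℕ} (he : 0 < e) (M : ℕ) : IsUnit (qFactor (X ^ e : ℚ⟦X⟧) M) := by
  rw [PowerSeries.isUnit_iff_constantCoeff, qFactor, map_prod]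
  simp [← pow_mul, he.ne']

lemma pow_dvd_qFactor_mul_sub_one {e a b L : ℕ} (he : 0 < e) {G : ℚ⟦X⟧} (ha : a ≤ L)
    (hb : L ≤ b) (hb' : b ≤ 2 * L)
    (hG : qFactor (X ^ e) a * qFactor (X ^ e) b * G = qFactor (X ^ e) (2 * L)) :
    X ^ (e * (a + 1)) ∣ qFactor (X ^ e) L * G - 1 := by
  rw [pow_mul, ← ((isUnit_qFactor he a).mul (isUnit_qFactor he b)).dvd_mul_left]
  have h : qFactor (X ^ e) a * qFactor (X ^ e) b * (qFactor (X ^ e) L * G - 1) =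
      qFactor (X ^ e) L * (qFactor (X ^ e) (2 * L) - qFactor (X ^ e) b) +
        qFactor (X ^ e) b * (qFactor (X ^ e) L - qFactor (X ^ e : ℚ⟦X⟧) a) := by
    linear_combination qFactor (X ^ e : ℚ⟦X⟧) L * hG
  rw [h]
  exact (((pow_dvd_pow _ (by omega)).trans (pow_dvd_qFactor_sub _ hb')).mul_left _).add
    ((pow_dvd_qFactor_sub _ ha).mul_left _)

lemma two_mul_choose_two (j : ℕ) : 2 * j.choose 2 + j = j * j := by
  induction j with
  | zero => rfl
  | succ j ih =>
    rw [Nat.choose_succ_succ' j 1, Nat.choose_one_right]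
    linarith

/-- A finite form of the Jacobi triple product identity. -/
lemma finite_triple_product (i d L : ℕ) :
    ∏ j ∈ Finset.range L, ((1 - X ^ (2 * (i + d) * j + i)) *
        (1 - X ^ (2 * (i + d) * j + (i + 2 * d)))) =
      ∑ n ∈ Finset.range (L + 1), (-1) ^ n * X ^ (n * ((i + d) * n + d)) *
          qBinom (X ^ (2 * (i + d))) (2 * L) (L - n) -
        ∑ n ∈ Finset.range L, (-1) ^ n * X ^ ((n + 1) * ((i + d) * n + i)) *
          qBinom (X ^ (2 * (i + d)) : ℚ⟦X⟧) (2 * L) (L + (n + 1)) := by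
  have key := prod_sub_mul_pow (X ^ (2 * (i + d)) : ℚ⟦X⟧) (X ^ (2 * (i + d) * L)) (X ^ i) (2 * L)
  have hE : (-1) ^ L * (X : ℚ⟦X⟧) ^ (2 * (i + d) * L * L + i * L + 2 * (i + d) * L.choose 2) ≠ 0 :=
    mul_ne_zero (pow_ne_zero _ (by simp)) (pow_ne_zero _ X_ne_zero)
  refine mul_left_cancel₀ hE ?_
  have hleft : ∏ j ∈ Finset.range (2 * L),
      ((X : ℚ⟦X⟧) ^ (2 * (i + d) * L) - X ^ i * (X ^ (2 * (i + d))) ^ j) =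
      (-1) ^ L * (X : ℚ⟦X⟧) ^ (2 * (i + d) * L * L + i * L + 2 * (i + d) * L.choose 2) *
        ∏ j ∈ Finset.range L, ((1 - X ^ (2 * (i + d) * j + i)) *
        (1 - X ^ (2 * (i + d) * j + (i + 2 * d)))) := by
    have hlow : ∏ j ∈ Finset.range L,
        ((X : ℚ⟦X⟧) ^ (2 * (i + d) * L) - X ^ i * (X ^ (2 * (i + d))) ^ j) =
        (-1) ^ L * X ^ (i * L + 2 * (i + d) * L.choose 2) *
          ∏ j ∈ Finset.range L, (1 - X ^ (2 * (i + d) * j + (i + 2 * d))) := by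
      have h (j : ℕ) (hj : j ∈ Finset.range L) :
          (X : ℚ⟦X⟧) ^ (2 * (i + d) * L) - X ^ i * (X ^ (2 * (i + d))) ^ j =
          -X ^ (i + 2 * (i + d) * j) * (1 - X ^ (2 * (i + d) * (L - 1 - j) + (i + 2 * d))) := by
        obtain ⟨t, rfl⟩ : ∃ t, L = t + 1 + j := ⟨L - 1 - j, by have := Finset.mem_range.1 hj; omega⟩
        rw [show t + 1 + j - 1 - j = t by omega]
        ring
      rw [Finset.prod_congr rfl h, Finset.prod_mul_distrib,
        Finset.prod_range_reflect (fun j => 1 - (X : ℚ⟦X⟧) ^ (2 * (i + d) * j + (i + 2 * d)))]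
      congr 1
      simp only [neg_eq_neg_one_mul ((X : ℚ⟦X⟧) ^ _), Finset.prod_mul_distrib, Finset.prod_const,
        Finset.card_range, Finset.prod_pow_eq_pow_sum, Finset.sum_add_distrib, Finset.sum_const,
        smul_eq_mul, Nat.choose_two_right, mul_comm L i]
      rw [← Finset.mul_sum, Finset.sum_range_id]
    have hhigh : ∏ j ∈ Finset.range L,
        ((X : ℚ⟦X⟧) ^ (2 * (i + d) * L) - X ^ i * (X ^ (2 * (i + d))) ^ (L + j)) =
        X ^ (2 * (i + d) * L * L) * ∏ j ∈ Finset.range L, (1 - X ^ (2 * (i + d) * j + i)) := by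
      have h (j : ℕ) : (X : ℚ⟦X⟧) ^ (2 * (i + d) * L) - X ^ i * (X ^ (2 * (i + d))) ^ (L + j) =
          X ^ (2 * (i + d) * L) * (1 - X ^ (2 * (i + d) * j + i)) := by
        ring
      rw [Finset.prod_congr rfl fun j _ => h j, Finset.prod_mul_distrib, Finset.prod_const,
        Finset.card_range, ← pow_mul]
    rw [two_mul, Finset.prod_range_add, hlow, hhigh, Finset.prod_mul_distrib]
    ring
  rw [← hleft, key, show 2 * L + 1 = L + 1 + L by ring, Finset.sum_range_add,
    ← Finset.sum_range_reflect _ (L + 1), mul_sub, sub_eq_add_neg, Finset.mul_sum, Finset.mul_sum,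
    ← Finset.sum_neg_distrib]
  congr 1
  · refine Finset.sum_congr rfl fun n hn => ?_
    obtain ⟨t, rfl⟩ : ∃ t, L = t + n := ⟨L - n, by have := Finset.mem_range.1 hn; omega⟩
    rw [show t + n + 1 - 1 - n = t by omega, show t + n - n = t by omega,
      show 2 * (t + n) - t = t + 2 * n by omega]
    have hsign : (-1 : ℚ⟦X⟧) ^ (t + n) * (-1) ^ n = (-1) ^ t := by
      rw [pow_add, mul_assoc, ← mul_pow]
      simp
    have hexp : 2 * (i + d) * t.choose 2 + i * t + 2 * (i + d) * (t + n) * (t + 2 * n) =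
        2 * (i + d) * (t + n) * (t + n) + i * (t + n) + 2 * (i + d) * (t + n).choose 2 +
          n * ((i + d) * n + d) := by
      have h₁ := two_mul_choose_two t
      have h₂ := two_mul_choose_two (t + n)
      zify at *
      linear_combination (i + d : ℤ) * h₁ - (i + d : ℤ) * h₂
    rw [← hsign, ← pow_mul, ← pow_mul, ← pow_mul]
    have hpow := congrArg (fun e => (X : ℚ⟦X⟧) ^ e) hexp
    simp only [pow_add] at hpow
    simp only [pow_add]
    linear_combination ((-1) ^ t * (-1) ^ n * (-1) ^ n *
      qBinom (X ^ (2 * (i + d)) : ℚ⟦X⟧) (2 * (t + n)) t) * hpow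
  · refine Finset.sum_congr rfl fun n hn => ?_
    obtain ⟨t, rfl⟩ : ∃ t, L = t + (n + 1) :=
      ⟨L - (n + 1), by have := Finset.mem_range.1 hn; omega⟩
    rw [show t + (n + 1) + 1 + n = t + 2 * n + 2 by omega,
      show t + (n + 1) + (n + 1) = t + 2 * n + 2 by omega,
      show 2 * (t + (n + 1)) - (t + 2 * n + 2) = t by omega]
    have hsign : (-1 : ℚ⟦X⟧) ^ (t + 2 * n + 2) = -((-1) ^ (t + (n + 1)) * (-1) ^ n) := by
      ring
    have hexp : 2 * (i + d) * (t + 2 * n + 2).choose 2 + i * (t + 2 * n + 2) +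
        2 * (i + d) * (t + (n + 1)) * t =
        2 * (i + d) * (t + (n + 1)) * (t + (n + 1)) + i * (t + (n + 1)) +
          2 * (i + d) * (t + (n + 1)).choose 2 + (n + 1) * ((i + d) * n + i) := by
      have h₁ := two_mul_choose_two (t + 2 * n + 2)
      have h₂ := two_mul_choose_two (t + (n + 1))
      zify at *
      linear_combination (i + d : ℤ) * h₁ - (i + d : ℤ) * h₂
    rw [hsign, ← pow_mul, ← pow_mul, ← pow_mul]
    have hpow := congrArg (fun e => (X : ℚ⟦X⟧) ^ e) hexp
    generalize qBinom (X ^ (2 * (i + d)) : ℚ⟦X⟧) (2 * (t + (n + 1))) (t + 2 * n + 2) = G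
    rw [pow_add, pow_add] at hpow
    rw [pow_add] at hpow
    linear_combination -((-1) ^ (t + (n + 1)) * (-1) ^ n * G) * hpow

/-- The Jacobi triple product identity, truncated. -/
lemma X_pow_dvd_theta_sub {i d L : ℕ} (hi : 1 ≤ i) (hL : 1 ≤ L) :
    X ^ (2 * (i + d) * L) ∣ ∑ n ∈ Finset.range (L + 1), (-1) ^ n *
        (X ^ (n * ((i + d) * n + d)) - X ^ ((n + 1) * ((i + d) * n + i))) -
      qFactor (X ^ (2 * (i + d))) L * ∏ j ∈ Finset.range L,
        ((1 - X ^ (2 * (i + d) * j + i)) * (1 - X ^ (2 * (i + d) * j + (i + 2 * d)) : ℚ⟦X⟧)) := by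
  have hk : 0 < 2 * (i + d) := by omega
  have hterm (e m : ℕ) (s G : ℚ⟦X⟧) (hG : X ^ m ∣ qFactor (X ^ (2 * (i + d))) L * G - 1)
      (he : 2 * (i + d) * L ≤ e + m) :
      X ^ (2 * (i + d) * L) ∣ s * X ^ e * (1 - qFactor (X ^ (2 * (i + d))) L * G) := by
    refine (pow_dvd_pow X he).trans ?_
    rw [pow_add, mul_comm s, mul_assoc, ← neg_sub _ (1 : ℚ⟦X⟧), mul_neg]
    exact mul_dvd_mul_left _ ((hG.mul_left s).neg_right)
  have hrw : ∑ n ∈ Finset.range (L + 1), (-1) ^ n *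
        (X ^ (n * ((i + d) * n + d)) - X ^ ((n + 1) * ((i + d) * n + i))) -
      qFactor (X ^ (2 * (i + d))) L * ∏ j ∈ Finset.range L,
        ((1 - X ^ (2 * (i + d) * j + i)) * (1 - X ^ (2 * (i + d) * j + (i + 2 * d)) : ℚ⟦X⟧)) =
      ∑ n ∈ Finset.range (L + 1), (-1) ^ n * X ^ (n * ((i + d) * n + d)) *
          (1 - qFactor (X ^ (2 * (i + d))) L * qBinom (X ^ (2 * (i + d))) (2 * L) (L - n)) -
        ∑ n ∈ Finset.range L, (-1) ^ n * X ^ ((n + 1) * ((i + d) * n + i)) *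
          (1 - qFactor (X ^ (2 * (i + d))) L *
            qBinom (X ^ (2 * (i + d)) : ℚ⟦X⟧) (2 * L) (L + (n + 1))) -
        (-1) ^ L * X ^ ((L + 1) * ((i + d) * L + i)) := by
    rw [finite_triple_product]
    simp only [mul_sub, mul_one, Finset.sum_sub_distrib, Finset.mul_sum]
    rw [Finset.sum_range_succ (fun n => (-1) ^ n * (X : ℚ⟦X⟧) ^ ((n + 1) * ((i + d) * n + i)))]
    simp only [mul_left_comm (qFactor (X ^ (2 * (i + d)) : ℚ⟦X⟧) L), mul_assoc]
    ring
  rw [hrw]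
  refine dvd_sub (dvd_sub (Finset.dvd_sum fun n hn => ?_) (Finset.dvd_sum fun n hn => ?_)) ?_
  · obtain ⟨t, rfl⟩ : ∃ t, L = t + n := ⟨L - n, by have := Finset.mem_range.1 hn; omega⟩
    rw [Nat.add_sub_cancel]
    have h := qFactor_mul_qBinom (X ^ (2 * (i + d)) : ℚ⟦X⟧) t (t + 2 * n)
    rw [show t + (t + 2 * n) = 2 * (t + n) by ring] at h
    refine hterm _ _ _ _ (pow_dvd_qFactor_mul_sub_one hk (by omega) (by omega) (by omega) h) ?_
    rcases n with _ | _ | n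
    · nlinarith
    · nlinarith
    · nlinarith [Nat.zero_le (n * n * (i + d)), Nat.zero_le (n * (i + d)), Nat.zero_le (n * d)]
  · obtain ⟨t, rfl⟩ : ∃ t, L = t + (n + 1) :=
      ⟨L - (n + 1), by have := Finset.mem_range.1 hn; omega⟩
    have h := qFactor_mul_qBinom (X ^ (2 * (i + d)) : ℚ⟦X⟧) (t + (n + 1) + (n + 1)) t
    rw [show t + (n + 1) + (n + 1) + t = 2 * (t + (n + 1)) by ring,
      mul_comm (qFactor _ (t + (n + 1) + (n + 1)))] at h
    refine hterm _ _ _ _ (pow_dvd_qFactor_mul_sub_one hk (by omega) (by omega) (by omega) h) ?_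
    rcases n with _ | n
    · nlinarith
    · nlinarith [Nat.zero_le (n * n * (i + d)), Nat.zero_le (n * (i + d)), Nat.zero_le (n * i)]
  · refine (pow_dvd_pow X ?_).mul_left _
    obtain ⟨t, rfl⟩ : ∃ t, L = t + 1 := ⟨L - 1, by omega⟩
    nlinarith [Nat.zero_le (t * t * (i + d)), Nat.zero_le (t * (i + d)), Nat.zero_le (t * i)]

end TripleProduct

/-- The product over the indices congruent to `0` or `±i` modulo `2 * (i + d)`. -/
lemma prod_residues_eq {i d : ℕ} (hi : 1 ≤ i) (hd : 1 ≤ d) (L : ℕ) :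
    ∏ u ∈ Finset.range (2 * (i + d) * L),
        (if (u + 1) % (2 * (i + d)) ≠ 0 ∧ (u + 1) % (2 * (i + d)) ≠ i ∧
          (u + 1) % (2 * (i + d)) ≠ 2 * (i + d) - i then 1 else 1 - X ^ (u + 1)) =
      qFactor (X ^ (2 * (i + d))) L * ∏ j ∈ Finset.range L,
        ((1 - X ^ (2 * (i + d) * j + i)) * (1 - X ^ (2 * (i + d) * j + (i + 2 * d)) : ℚ⟦X⟧)) := by
  induction L with
  | zero => simp [qFactor]
  | succ L ih =>
    rw [Nat.mul_succ, Finset.prod_range_add, ih, qFactor_succ, Finset.prod_range_succ _ L]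
    have hsub : ({i - 1, i + 2 * d - 1, 2 * (i + d) - 1} : Finset ℕ) ⊆
        Finset.range (2 * (i + d)) := by
      intro x
      simp only [Finset.mem_insert, Finset.mem_singleton, Finset.mem_range]
      omega
    rw [← Finset.prod_subset hsub]
    · have h₁ : (2 * (i + d) * L + (i - 1) + 1) % (2 * (i + d)) = i := by
        rw [add_assoc, Nat.mul_add_mod, Nat.mod_eq_of_lt] <;> omega
      have h₂ : (2 * (i + d) * L + (i + 2 * d - 1) + 1) % (2 * (i + d)) = 2 * (i + d) - i := by
        rw [add_assoc, Nat.mul_add_mod, Nat.mod_eq_of_lt] <;> omega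
      have h₃ : (2 * (i + d) * L + (2 * (i + d) - 1) + 1) % (2 * (i + d)) = 0 := by
        rw [add_assoc, Nat.mul_add_mod, Nat.sub_add_cancel (by omega), Nat.mod_self]
      rw [Finset.prod_insert, Finset.prod_insert, Finset.prod_singleton, if_neg (by simp [h₁]),
        if_neg (by simp [h₂]), if_neg (by simp [h₃]), ← pow_mul, Nat.mul_succ,
        show 2 * (i + d) * L + (i - 1) + 1 = 2 * (i + d) * L + i by omega,
        show 2 * (i + d) * L + (i + 2 * d - 1) + 1 = 2 * (i + d) * L + (i + 2 * d) by omega,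
        show 2 * (i + d) * L + (2 * (i + d) - 1) + 1 = 2 * (i + d) * L + 2 * (i + d) by omega]
      · ring
      · simp only [Finset.mem_singleton]
        omega
      · simp only [Finset.mem_insert, Finset.mem_singleton]
        omega
    · intro u hu hu'
      simp only [Finset.mem_insert, Finset.mem_singleton, Finset.mem_range] at hu hu'
      have hmod : (2 * (i + d) * L + u + 1) % (2 * (i + d)) = u + 1 := by
        rw [add_assoc, Nat.mul_add_mod, Nat.mod_eq_of_lt]
        omega
      rw [hmod, if_pos (by omega)]

lemma X_pow_dvd_gordonSeries_add_sub {i d L : ℕ} (hi : 1 ≤ i) (hd : 1 ≤ d) (hL : 1 ≤ L) :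
    X ^ (2 * (i + d) * L) ∣
      gordonSeries (i + d) (i - 1) 1 + gordonSeries (i + d) i 1 -
        cardSeries (superSet (fun w => w % (2 * (i + d)) ≠ 0 ∧ w % (2 * (i + d)) ≠ i ∧
          w % (2 * (i + d)) ≠ 2 * (i + d) - i) (2 * (i + d) * L)) := by
  set A : ℕ → Prop := fun w => w % (2 * (i + d)) ≠ 0 ∧ w % (2 * (i + d)) ≠ i ∧
    w % (2 * (i + d)) ≠ 2 * (i + d) - i
  set W := 2 * (i + d) * L
  have hWL : W ≤ (L + 1) * ((i + d) * L + 1) := by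
    change 2 * (i + d) * L ≤ _
    obtain ⟨t, rfl⟩ : ∃ t, L = t + 1 := ⟨L - 1, by omega⟩
    nlinarith [Nat.zero_le (t * t * (i + d)), Nat.zero_le (t * (i + d))]
  have h₁ := X_pow_dvd_gordonDefect (k := i + d) (by omega) hWL (Nat.zero_le W) (i - 1) (by omega)
  have h₂ := X_pow_dvd_gordonDefect (k := i + d) (by omega) hWL (Nat.zero_le W) i (by omega)
  have h₃ := X_pow_dvd_theta_sub (d := d) hi hL
  rw [← prod_residues_eq hi hd L] at h₃
  change X ^ W ∣ _ - ∏ u ∈ Finset.range W, (if A (u + 1) then 1 else 1 - X ^ (u + 1)) at h₃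
  have h₄ := prod_mul_cardSeries_superSet A W
  have htheta := thetaSum_add_thetaSum_succ L (i - 1) d
  rw [Nat.sub_add_cancel hi] at htheta
  have hprod : (∏ u ∈ Finset.range W, if A (u + 1) then (1 - X ^ (u + 1) : ℚ⟦X⟧) else 1) *
      ∏ u ∈ Finset.range W, (if A (u + 1) then 1 else 1 - X ^ (u + 1)) =
      ∏ u ∈ Finset.range W, (1 - X ^ (u + 1)) := by
    rw [← Finset.prod_mul_distrib]
    refine Finset.prod_congr rfl fun u _ => ?_
    split_ifs <;> simp
  have hunit : IsUnit (∏ u ∈ Finset.range W, (1 - X ^ (u + 1) : ℚ⟦X⟧)) := by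
    simpa [qFactor] using isUnit_qFactor one_pos W
  rw [← hunit.dvd_mul_left]
  unfold gordonDefect at h₁ h₂
  have h₅ := (h₁.add h₂).add (h₃.mul_left (2 * ∏ u ∈ Finset.range W, (1 + X ^ (u + 1))))
  convert h₅ using 1
  simp only [zero_add]
  linear_combination cardSeries (superSet A W) * hprod -
    (∏ u ∈ Finset.range W, (if A (u + 1) then 1 else 1 - X ^ (u + 1))) * h₄ +
    (∏ u ∈ Finset.range W, (1 + X ^ (u + 1))) * htheta

end GeneratingFunctions

/-- **Theorem 7.2.** For `1 ≤ i ≤ k-1`, the number of overpartitions counted by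
`B̄_{k,i}(n)` plus the number counted by `B̄_{k,i+1}(n)` equals the number of
superpartitions of `n` whose non-overlined parts are not congruent to `0, ±i`
modulo `2k`. -/
theorem gordon_superpartitions (k i n : ℕ) (hi : 1 ≤ i) (hik : i ≤ k - 1) (hn : 0 < n) :
    Nat.card {l : List (ℕ × Bool) // BCond k i l ∧ opWeight l = n} +
      Nat.card {l : List (ℕ × Bool) // BCond k (i + 1) l ∧ opWeight l = n} =
      Nat.card {l : List (ℕ × Bool) //
        IsSuperpartition l ∧ opWeight l = n ∧
          ∀ p ∈ l, p.2 = false →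
            p.1 % (2 * k) ≠ 0 ∧ p.1 % (2 * k) ≠ i ∧ p.1 % (2 * k) ≠ 2 * k - i} := by
  obtain ⟨d, rfl⟩ : ∃ d, k = i + d := ⟨k - i, by omega⟩
  have hd : 1 ≤ d := by omega
  have hgordon (j : ℕ) :
      Nat.card {l : List (ℕ × Bool) // BCond (i + d) j l ∧ opWeight l = n} =
        (gordonSet (i + d) (j - 1) 1 n).ncard := by
    rw [← Nat.card_coe_set_eq]
    refine Nat.card_congr (Equiv.subtypeEquivRight fun l => ?_)
    simp only [BCond, gordonSet, Set.mem_ofPred_eq]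
    exact ⟨fun h => ⟨h.1.1, h.1.1.1, h.1.2.1, h.1.2.2, h.2⟩,
      fun h => ⟨⟨h.1, h.2.2.1, h.2.2.2.1⟩, h.2.2.2.2⟩⟩
  have hnW : n < 2 * (i + d) * (n + 1) := by nlinarith
  have hsuper : Nat.card {l : List (ℕ × Bool) //
        IsSuperpartition l ∧ opWeight l = n ∧
          ∀ p ∈ l, p.2 = false → p.1 % (2 * (i + d)) ≠ 0 ∧ p.1 % (2 * (i + d)) ≠ i ∧
            p.1 % (2 * (i + d)) ≠ 2 * (i + d) - i} =
      (superSet (fun w => w % (2 * (i + d)) ≠ 0 ∧ w % (2 * (i + d)) ≠ i ∧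
          w % (2 * (i + d)) ≠ 2 * (i + d) - i) (2 * (i + d) * (n + 1)) n).ncard := by
    rw [← Nat.card_coe_set_eq]
    refine Nat.card_congr (Equiv.subtypeEquivRight fun l => ?_)
    simp only [superSet, Set.mem_ofPred_eq]
    refine ⟨fun h => ⟨h.1, fun p hp => ?_, h.2.2, h.2.1⟩, fun h => ⟨h.1, h.2.2.2, h.2.2.1⟩⟩
    have hle : p.1 ≤ opWeight l := List.le_sum_of_mem (List.mem_map_of_mem hp)
    omega
  have hcoeff := PowerSeries.X_pow_dvd_iff.1
    (X_pow_dvd_gordonSeries_add_sub hi hd (Nat.le_add_left 1 n)) n hnW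
  rw [hgordon, hgordon, hsuper, Nat.add_sub_cancel]
  simp only [map_sub, map_add, gordonSeries, cardSeries, PowerSeries.coeff_mk, sub_eq_zero]
    at hcoeff
  exact_mod_cast hcoeff

end Paper
end
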